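/- arXiv:math/0304401 — 2 statements merged into one kernel-verified Lean document; each statement's English description precedes it below -/
import Mathlib

section
/- Let p be a prime number, let G be a finite p-group, and let χ be an irreducible complex character of G with χ(1) = p^n. Then the number of distinct irreducible constituents of the product character χ·χ̄ satisfies η(χ, χ̄) ≥ 2n(p−1) + 1. -/
open scoped Classical

/-- The inner product of two class functions on a finite group. -/
noncomputable def charInner (G : Type) [Group G] (φ ψ : G → ℂ) : ℂ :=
  (Nat.card G : ℂ)⁻¹ * ∑ᶠ g : G, φ g * (starRingEnd ℂ) (ψ g)

/-- `χ` is an irreducible complex character of `G`. -/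
def IsIrrChar (G : Type) [Group G] (χ : G → ℂ) : Prop :=
  ∃ V : FDRep ℂ G, CategoryTheory.Simple V ∧ V.character = χ

/-- The complex conjugate of a character. -/
def conjChar {G : Type} (χ : G → ℂ) : G → ℂ := fun g => (starRingEnd ℂ) (χ g)

/-- The set of irreducible constituents of a character `Θ` of `G`. -/
def constituents (G : Type) [Group G] (Θ : G → ℂ) : Set (G → ℂ) :=
  {θ | IsIrrChar G θ ∧ charInner G θ Θ ≠ 0}

/-- `η χ ψ` : the number of distinct irreducible constituents of the product `χ ψ`. -/
noncomputable def eta (G : Type) [Group G] (χ ψ : G → ℂ) : ℕ :=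
  (constituents G (χ * ψ)).ncard

/-- The character of `G` induced from the character `γ` of a subgroup `H`. -/
noncomputable def indChar {G : Type} [Group G] (H : Subgroup G) (γ : ↥H → ℂ) : G → ℂ :=
  fun g => (Nat.card ↥H : ℂ)⁻¹ *
    ∑ᶠ x : G, if h : x * g * x⁻¹ ∈ H then γ ⟨x * g * x⁻¹, h⟩ else 0

/-- Restriction of a character of `G` to a subgroup `M`. -/
def resChar {G : Type} [Group G] (M : Subgroup G) (χ : G → ℂ) : ↥M → ℂ := fun m => χ (m : G)

/-- Restriction of a character of a subgroup `M` to a smaller subgroup `N ≤ M`. -/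
def resChar₂ {G : Type} [Group G] {N M : Subgroup G} (h : N ≤ M) (μ : ↥M → ℂ) : ↥N → ℂ :=
  fun n => μ ⟨n.1, h n.2⟩

/-- The character of `M` induced from the character `ν` of `N`, where `N ≤ M` are
subgroups of `G`. -/
noncomputable def indCharSub {G : Type} [Group G] (N M : Subgroup G) (ν : ↥N → ℂ) : ↥M → ℂ :=
  indChar (N.subgroupOf M) (fun x => ν ⟨x.1.1, x.2⟩)

/-- The inertia group (stabilizer) `G_ν` of a character `ν` of a normal subgroup `N` of `G`. -/
def inertia {G : Type} [Group G] (N : Subgroup G) (hN : N.Normal) (ν : ↥N → ℂ) : Subgroup G where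
  carrier := {g : G | ∀ n : ↥N, ν (@MulAut.conjNormal G _ N hN g n) = ν n}
  one_mem' := by intro n; simp
  mul_mem' := by
    intro a b ha hb n
    rw [map_mul]
    exact (ha _).trans (hb n)
  inv_mem' := by
    intro a ha n
    have h := ha ((@MulAut.conjNormal G _ N hN a)⁻¹ n)
    rw [MulAut.apply_inv_self] at h
    rw [map_inv]
    exact h.symm

/-- `M/N` is a chief factor of `G`. -/
structure IsChiefFactor {G : Type} [Group G] (N M : Subgroup G) : Prop where
  normalN : N.Normal
  normalM : M.Normal
  lt : N < M
  max : ∀ K : Subgroup G, K.Normal → N ≤ K → K ≤ M → K = N ∨ K = M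

namespace CharProduct

open Representation Module

section Conj

variable {G V : Type} [Group G] [Finite G] [AddCommGroup V] [Module ℂ V] [FiniteDimensional ℂ V]

open scoped ComplexOrder in
/-- A complex character of a finite group takes conjugate values at inverse elements. -/
theorem character_inv (ρ : Representation ℂ G V) (g : G) :
    ρ.character g⁻¹ = starRingEnd ℂ (ρ.character g) := by
  have := Fintype.ofFinite G
  let b := finBasis ℂ V
  let A : G → Matrix (Fin (finrank ℂ V)) (Fin (finrank ℂ V)) ℂ :=
    fun g => LinearMap.toMatrix b b (ρ g)
  have hA : ∀ x y, A (x * y) = A x * A y := fun x y => by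
    simp only [A, map_mul]
    exact LinearMap.toMatrix_mul b _ _
  have hA1 : A 1 = 1 := by simp [A]
  have htr : ∀ x, ρ.character x = (A x).trace := fun x =>
    LinearMap.trace_eq_matrix_trace ℂ b (ρ x)
  let H := ∑ x, (A x).conjTranspose * A x
  have hH : IsUnit H := by
    have : H.PosDef := by
      have h1 : H = 1 + ∑ x ∈ Finset.univ.erase 1, (A x).conjTranspose * A x := by
        have := Finset.add_sum_erase Finset.univ (fun x => (A x).conjTranspose * A x)
          (Finset.mem_univ (1 : G))
        simp only [hA1, Matrix.conjTranspose_one, mul_one] at this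
        exact this.symm
      rw [h1]
      exact Matrix.PosDef.one.add_posSemidef
        (Matrix.posSemidef_sum _ fun x _ => Matrix.posSemidef_conjTranspose_mul_self (A x))
    exact this.isUnit
  have hinv : (A g).conjTranspose * H * A g = H := by
    simp only [H, Finset.mul_sum, Finset.sum_mul]
    refine Fintype.sum_equiv (Equiv.mulRight g) _ _ fun x => ?_
    simp [hA, Matrix.conjTranspose_mul, Matrix.mul_assoc]
  have h2 : (A g).conjTranspose * H = H * A g⁻¹ := by
    calc (A g).conjTranspose * H = (A g).conjTranspose * H * (A g * A g⁻¹) := by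
          rw [← hA, mul_inv_cancel, hA1, mul_one]
      _ = H * A g⁻¹ := by rw [← mul_assoc, hinv]
  obtain ⟨u, hu⟩ := hH
  have h3 : A g⁻¹ = (↑u⁻¹ : Matrix (Fin (finrank ℂ V)) (Fin (finrank ℂ V)) ℂ) *
      ((A g).conjTranspose * (u : Matrix (Fin (finrank ℂ V)) (Fin (finrank ℂ V)) ℂ)) := by
    rw [hu, h2, ← hu, ← mul_assoc, Units.inv_mul, one_mul]
  rw [htr, htr, h3, Matrix.trace_mul_comm, mul_assoc, Units.mul_inv, mul_one,
    Matrix.trace_conjTranspose]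
  rfl

theorem finrank_intertwiningMap_eq {W : Type} [AddCommGroup W] [Module ℂ W]
    [FiniteDimensional ℂ W] (ρ : Representation ℂ G V) (σ : Representation ℂ G W) :
    (finrank ℂ (IntertwiningMap ρ σ) : ℂ) =
      starRingEnd ℂ (charInner G ρ.character σ.character) := by
  have := Fintype.ofFinite G
  have : Invertible (Nat.card G : ℂ) :=
    invertibleOfNonzero (Nat.cast_ne_zero.2 Nat.card_pos.ne')
  rw [← card_inv_mul_sum_char_mul_char_eq_finrank, charInner, finsum_eq_sum_of_fintype]
  simp [character_inv, map_sum, mul_comm]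

theorem charInner_ne_zero {W : Type} [AddCommGroup W] [Module ℂ W]
    [FiniteDimensional ℂ W] (ρ : Representation ℂ G V) (σ : Representation ℂ G W)
    (f : IntertwiningMap ρ σ) (hf : f ≠ 0) : charInner G ρ.character σ.character ≠ 0 := by
  have : FiniteDimensional ℂ (IntertwiningMap ρ σ) :=
    (invariantsEquivIntertwiningMap ρ σ).finiteDimensional
  intro h
  have h1 := finrank_intertwiningMap_eq ρ σ
  rw [h, map_zero, Nat.cast_eq_zero, finrank_zero_iff] at h1
  exact hf (Subsingleton.elim _ _)

theorem simple_of_isIrreducible (ρ : Representation ℂ G V) [IsIrreducible ρ] :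
    CategoryTheory.Simple (FDRep.of ρ) := by
  have := Fintype.ofFinite G
  have : Invertible (Nat.card G : ℂ) :=
    invertibleOfNonzero (Nat.cast_ne_zero.2 Nat.card_pos.ne')
  rw [FDRep.simple_iff_char_is_norm_one]
  have h := card_inv_mul_sum_char_mul_char_eq_finrank ρ ρ
  rw [IsIrreducible.finrank_intertwiningMap_self, Nat.cast_one, inv_mul_eq_one₀
    (Nat.cast_ne_zero.2 Nat.card_pos.ne')] at h
  exact h.symm

omit [Finite G] in
/-- A nonzero stable subspace contains an irreducible subrepresentation. -/
theorem exists_irreducible_le (ρ : Representation ℂ G V) (E : Submodule ℂ V) (hE : E ≠ ⊥)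
    (hst : ∀ g, ∀ v ∈ E, ρ g v ∈ E) :
    ∃ U : Subrepresentation ρ, U.toSubmodule ≤ E ∧ U.toSubmodule ≠ ⊥ ∧
      IsIrreducible U.toRepresentation := by
  obtain ⟨S, ⟨hS0, hSE, hSst⟩, hmin⟩ := (wellFounded_lt (α := Submodule ℂ V)).has_min
    {S | S ≠ ⊥ ∧ S ≤ E ∧ ∀ g, ∀ v ∈ S, ρ g v ∈ S} ⟨E, hE, le_rfl, hst⟩
  let U : Subrepresentation ρ := ⟨S, fun g v hv => hSst g v hv⟩
  refine ⟨U, hSE, hS0, ?_⟩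
  have hnt : Nontrivial S := Submodule.nontrivial_iff_ne_bot.2 hS0
  refine { exists_pair_ne := ⟨⊥, ⊤, fun h => ?_⟩, eq_bot_or_eq_top := fun T => ?_ }
  · have h1 : (⊥ : Submodule ℂ S) = ⊤ := congrArg Subrepresentation.toSubmodule h
    exact bot_ne_top h1
  · by_cases hT : T.toSubmodule = ⊥
    · exact Or.inl (Subrepresentation.toSubmodule_injective hT)
    · right
      apply Subrepresentation.toSubmodule_injective
      change T.toSubmodule = ⊤
      have hle : T.toSubmodule.map S.subtype ≤ S := Submodule.map_subtype_le _ _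
      have h1 : ¬ T.toSubmodule.map S.subtype < S := hmin _ ⟨?_, hle.trans hSE, ?_⟩
      · have h2 := eq_of_le_of_not_lt hle h1
        apply Submodule.map_injective_of_injective S.injective_subtype
        rw [h2]
        simp
      · intro h
        exact hT (Submodule.map_injective_of_injective S.injective_subtype
          (h.trans (Submodule.map_bot _).symm))
      · rintro g _ ⟨v, hv, rfl⟩
        exact ⟨_, T.apply_mem_toSubmodule g hv, rfl⟩

/-- The inclusion of a subrepresentation. -/
def inclusion {ρ : Representation ℂ G V} (U : Subrepresentation ρ) :
    IntertwiningMap U.toRepresentation ρ :=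
  ⟨U.toSubmodule.subtype, fun _ => rfl⟩

omit [Finite G] [FiniteDimensional ℂ V] in
theorem inclusion_ne_zero {ρ : Representation ℂ G V} (U : Subrepresentation ρ)
    (hU : U.toSubmodule ≠ ⊥) : inclusion U ≠ 0 := by
  obtain ⟨x, hx, hx0⟩ := Submodule.exists_mem_ne_zero_of_ne_bot hU
  intro h
  exact hx0 (DFunLike.congr_fun h (⟨x, hx⟩ : U.toSubmodule))

theorem isIrreducible_of_simple (V : FDRep ℂ G) [CategoryTheory.Simple V] :
    IsIrreducible V.ρ := by
  have := Fintype.ofFinite G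
  have : Invertible (Nat.card G : ℂ) :=
    invertibleOfNonzero (Nat.cast_ne_zero.2 Nat.card_pos.ne')
  have hchar := FDRep.char_orthonormal V V
  have hnt : Nontrivial V := by
    by_contra h
    rw [not_nontrivial_iff_subsingleton] at h
    have h0 : V.character = 0 := by
      ext g
      have : V.ρ g = 0 := by ext x; exact Subsingleton.elim _ _
      simp [FDRep.character, this]
    rw [if_pos ⟨CategoryTheory.Iso.refl V⟩] at hchar
    simp [h0] at hchar
  refine { exists_pair_ne := ⟨⊥, ⊤, fun h => ?_⟩, eq_bot_or_eq_top := fun T => ?_ }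
  · have h1 : (⊥ : Submodule ℂ V) = ⊤ := congrArg Subrepresentation.toSubmodule h
    exact bot_ne_top h1
  · by_cases hT : T.toSubmodule = ⊥
    · exact Or.inl (Subrepresentation.toSubmodule_injective hT)
    · right
      apply Subrepresentation.toSubmodule_injective
      change T.toSubmodule = ⊤
      obtain ⟨U, hUT, hU0, hU⟩ := exists_irreducible_le V.ρ T.toSubmodule hT
        fun g v hv => T.apply_mem_toSubmodule g hv
      have hs := simple_of_isIrreducible U.toRepresentation
      have h1 := FDRep.char_orthonormal V (FDRep.of U.toRepresentation)
      have h2 := charInner_ne_zero _ _ _ (inclusion_ne_zero U hU0)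
      have h3 : (Nat.card G : ℂ)⁻¹ * ∑ g : G, V.character g *
          (FDRep.of U.toRepresentation).character g⁻¹ ≠ 0 := by
        have h4 := finrank_intertwiningMap_eq U.toRepresentation V.ρ
        rw [← card_inv_mul_sum_char_mul_char_eq_finrank] at h4
        intro h5
        refine h2 ((map_eq_zero (starRingEnd ℂ)).1 (h4.symm.trans h5))
      rw [h1] at h3
      have hiso : Nonempty (V ≅ FDRep.of U.toRepresentation) := by
        by_contra h; simp [h] at h3
      obtain ⟨i⟩ := hiso
      have h6 : finrank ℂ V = finrank ℂ U.toSubmodule :=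
        (FDRep.isoToLinearEquiv i).finrank_eq
      exact top_le_iff.1 ((Submodule.eq_top_of_finrank_eq h6.symm) ▸ hUT)

/-- A finite group has finitely many irreducible complex characters. -/
theorem finite_isIrrChar (G : Type) [Group G] [Finite G] : {θ | IsIrrChar G θ}.Finite := by
  have := Fintype.ofFinite G
  have : Invertible (Nat.card G : ℂ) :=
    invertibleOfNonzero (Nat.cast_ne_zero.2 Nat.card_pos.ne')
  let B : LinearMap.BilinForm ℂ (G → ℂ) := LinearMap.mk₂ ℂ
    (fun f h => (Nat.card G : ℂ)⁻¹ * ∑ g, f g * h g⁻¹)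
    (by intros; simp [add_mul, Finset.sum_add_distrib, mul_add])
    (by intros; simp [Finset.mul_sum, mul_left_comm, mul_assoc])
    (by intros; simp [Finset.sum_add_distrib, mul_add])
    (by intros; simp [Finset.mul_sum, mul_left_comm])
  have hli : LinearIndependent ℂ (fun θ : {θ | IsIrrChar G θ} => (θ : G → ℂ)) := by
    refine LinearMap.BilinForm.linearIndependent_of_iIsOrtho (B := B) ?_ ?_
    · rintro ⟨_, V, hV, rfl⟩ ⟨_, W, hW, rfl⟩ hne
      have h := FDRep.char_orthonormal V W
      rw [if_neg] at h
      · exact h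
      · rintro ⟨i⟩
        exact hne (Subtype.ext (FDRep.char_iso i))
    · rintro ⟨_, V, hV, rfl⟩ h0
      have h := FDRep.char_orthonormal V V
      rw [if_pos ⟨CategoryTheory.Iso.refl V⟩] at h
      exact one_ne_zero (h.symm.trans h0)
  exact hli.setFinite

end Conj

section Group

/-- A proper normal subgroup `N` of a finite `p`-group has a chief factor `M / N` above it, which
is central of order `p`. -/
theorem exists_central_extension {p : ℕ} (hp : p.Prime) {G : Type} [Group G] [Finite G]
    (hG : IsPGroup p G) (N : Subgroup G) [N.Normal] (hN : N ≠ ⊤) :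
    ∃ (M : Subgroup G) (z : G), M.Normal ∧ N < M ∧ Nat.card M = p * Nat.card N ∧
      z ∈ M ∧ z ^ p ∈ N ∧ (∀ m ∈ M, ∃ k : ℕ, ∃ x ∈ N, m = z ^ k * x) ∧
      ∀ g, ∃ x ∈ N, z * g = g * z * x := by
  have : Fact p.Prime := ⟨hp⟩
  have hQ : IsPGroup p (G ⧸ N) := hG.to_quotient N
  have : Nontrivial (G ⧸ N) := QuotientGroup.nontrivial_iff.2 hN
  have hc : Nontrivial (Subgroup.center (G ⧸ N)) := hQ.center_nontrivial
  have hdvd : p ∣ Nat.card (Subgroup.center (G ⧸ N)) := by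
    obtain ⟨k, hk, h⟩ := (hQ.to_subgroup (Subgroup.center (G ⧸ N))).nontrivial_iff_card.1 hc
    rw [h]
    exact dvd_pow_self p hk.ne'
  obtain ⟨⟨c, hcc⟩, hord⟩ := exists_prime_orderOf_dvd_card' p hdvd
  rw [Subgroup.orderOf_mk] at hord
  obtain ⟨z, rfl⟩ := QuotientGroup.mk'_surjective N c
  have hcomm : ∀ g : G ⧸ N, g * QuotientGroup.mk' N z = QuotientGroup.mk' N z * g :=
    Subgroup.mem_center_iff.1 hcc
  let Z := Subgroup.zpowers (QuotientGroup.mk' N z)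
  have hZ : Z.Normal := ⟨fun a ha g => by
    obtain ⟨k, rfl⟩ := Subgroup.mem_zpowers_iff.1 ha
    have : g * QuotientGroup.mk' N z ^ k = QuotientGroup.mk' N z ^ k * g :=
      (show Commute g _ from hcomm g).zpow_right k
    rw [this, mul_inv_cancel_right]
    exact ha⟩
  have hker : ∀ x y : G, QuotientGroup.mk' N x = QuotientGroup.mk' N y → x⁻¹ * y ∈ N :=
    fun x y h => QuotientGroup.eq.1 h
  refine ⟨Z.comap (QuotientGroup.mk' N), z, hZ.comap _, ?_, ?_, ?_, ?_, ?_, ?_⟩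
  · refine lt_of_le_of_ne (fun x hx => ?_) (fun h => ?_)
    · have : QuotientGroup.mk' N x = 1 := (QuotientGroup.eq_one_iff x).2 hx
      rw [Subgroup.mem_comap, this]
      exact one_mem _
    · have hz : z ∈ N := by
        rw [h]
        exact Subgroup.mem_zpowers _
      have : QuotientGroup.mk' N z = 1 := (QuotientGroup.eq_one_iff z).2 hz
      rw [this, orderOf_one] at hord
      exact hp.one_lt.ne hord
  · have h1 := (Z.comap (QuotientGroup.mk' N)).card_mul_index
    rw [Subgroup.index_comap_of_surjective _ (QuotientGroup.mk'_surjective N)] at h1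
    have h2 := N.card_mul_index
    have h3 : N.index = Nat.card Z * Z.index := Z.card_mul_index.symm
    have h4 : Nat.card Z = p := by rw [Nat.card_zpowers, hord]
    rw [h3, h4] at h2
    have h5 : Z.index ≠ 0 := Subgroup.index_ne_zero_of_finite
    apply Nat.eq_of_mul_eq_mul_right (Nat.pos_of_ne_zero h5)
    rw [h1, ← h2]
    ring
  · exact Subgroup.mem_zpowers _
  · rw [← QuotientGroup.eq_one_iff]
    have := pow_orderOf_eq_one (QuotientGroup.mk' N z)
    rwa [hord, ← map_pow] at this
  · intro m hm
    rw [Subgroup.mem_comap, mem_zpowers_iff_mem_range_orderOf, Finset.mem_image] at hm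
    obtain ⟨k, -, hk⟩ := hm
    rw [← map_pow] at hk
    exact ⟨k, _, hker _ _ hk, by group⟩
  · intro g
    refine ⟨_, hker (g * z) (z * g) ?_, by group⟩
    rw [map_mul, map_mul]
    exact hcomm _

end Group

section Levels

variable {G V : Type} [Group G] [AddCommGroup V] [Module ℂ V]

/-- The endomorphisms of `V` fixed by a subgroup `N` under conjugation. -/
noncomputable def fixedEnd (ρ : Representation ℂ G V) (N : Subgroup G) : Submodule ℂ (V →ₗ[ℂ] V) :=
  invariants ((linHom ρ ρ).comp N.subtype)

/-- The endomorphisms of `V` fixed by `N` on which `z` acts by conjugation as the scalar `ζ`. -/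
noncomputable def eigenEnd (ρ : Representation ℂ G V) (N : Subgroup G) (z : G) (ζ : ℂ) :
    Submodule ℂ (V →ₗ[ℂ] V) :=
  fixedEnd ρ N ⊓ LinearMap.ker (linHom ρ ρ z - ζ • 1)

theorem mem_fixedEnd {ρ : Representation ℂ G V} {N : Subgroup G} {f : V →ₗ[ℂ] V} :
    f ∈ fixedEnd ρ N ↔ ∀ x ∈ N, linHom ρ ρ x f = f :=
  ⟨fun h x hx => h ⟨x, hx⟩, fun h x => h x x.2⟩

theorem mem_eigenEnd {ρ : Representation ℂ G V} {N : Subgroup G} {z : G} {ζ : ℂ}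
    {f : V →ₗ[ℂ] V} : f ∈ eigenEnd ρ N z ζ ↔
      (∀ x ∈ N, linHom ρ ρ x f = f) ∧ linHom ρ ρ z f = ζ • f := by
  simp [eigenEnd, mem_fixedEnd, sub_eq_zero]

theorem linHom_comp (ρ : Representation ℂ G V) (g : G) (f f' : V →ₗ[ℂ] V) :
    linHom ρ ρ g (f ∘ₗ f') = linHom ρ ρ g f ∘ₗ linHom ρ ρ g f' := by
  ext v
  simp [linHom_apply]

theorem fixedEnd_stable (ρ : Representation ℂ G V) (N : Subgroup G) [hN : N.Normal] (g : G)
    {f : V →ₗ[ℂ] V} (hf : f ∈ fixedEnd ρ N) : linHom ρ ρ g f ∈ fixedEnd ρ N := by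
  rw [mem_fixedEnd] at hf ⊢
  intro x hx
  have h1 : x * g = g * (g⁻¹ * x * g) := by group
  have h2 : g⁻¹ * x * g ∈ N := by simpa using hN.conj_mem x hx g⁻¹
  rw [← Module.End.mul_apply, ← map_mul, h1, map_mul, Module.End.mul_apply, hf _ h2]

theorem eigenEnd_stable (ρ : Representation ℂ G V) (N : Subgroup G) [N.Normal] {z : G}
    (hz : ∀ g, ∃ x ∈ N, z * g = g * z * x) (ζ : ℂ) (g : G) (f : V →ₗ[ℂ] V)
    (hf : f ∈ eigenEnd ρ N z ζ) : linHom ρ ρ g f ∈ eigenEnd ρ N z ζ := by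
  have h1 := mem_fixedEnd.1 (fixedEnd_stable ρ N g hf.1)
  rw [mem_eigenEnd] at hf ⊢
  refine ⟨h1, ?_⟩
  obtain ⟨x, hx, h⟩ := hz g
  rw [← Module.End.mul_apply, ← map_mul, h, map_mul, map_mul, Module.End.mul_apply, hf.1 x hx,
    Module.End.mul_apply, hf.2, map_smul]

theorem comp_mem_eigenEnd {ρ : Representation ℂ G V} {N : Subgroup G} {z : G} {ζ ξ : ℂ}
    {f f' : V →ₗ[ℂ] V} (hf : f ∈ eigenEnd ρ N z ζ) (hf' : f' ∈ eigenEnd ρ N z ξ) :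
    f ∘ₗ f' ∈ eigenEnd ρ N z (ζ * ξ) := by
  rw [mem_eigenEnd] at *
  refine ⟨fun x hx => ?_, ?_⟩
  · rw [linHom_comp, hf.1 x hx, hf'.1 x hx]
  · rw [linHom_comp, hf.2, hf'.2, LinearMap.smul_comp, LinearMap.comp_smul, smul_smul]

/-- The eigenspaces of `z` on `End V` are closed under products. -/
theorem eigenEnd_mul_ne_bot {ρ : Representation ℂ G V} [IsIrreducible ρ] {N : Subgroup G}
    [N.Normal] {z : G} (hz : ∀ g, ∃ x ∈ N, z * g = g * z * x) {ζ ξ : ℂ}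
    (hζ : eigenEnd ρ N z ζ ≠ ⊥) (hξ : eigenEnd ρ N z ξ ≠ ⊥) : eigenEnd ρ N z (ζ * ξ) ≠ ⊥ := by
  intro hbot
  obtain ⟨f, hf, hf0⟩ := Submodule.exists_mem_ne_zero_of_ne_bot hζ
  obtain ⟨f', hf', hf'0⟩ := Submodule.exists_mem_ne_zero_of_ne_bot hξ
  let S : Subrepresentation ρ :=
    { toSubmodule := ⨆ h : eigenEnd ρ N z ξ, LinearMap.range h.1
      apply_mem_toSubmodule := fun g v hv => by
        have hle : (⨆ h : eigenEnd ρ N z ξ, LinearMap.range h.1) ≤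
            (⨆ h : eigenEnd ρ N z ξ, LinearMap.range h.1).comap (ρ g) := by
          refine iSup_le fun h => ?_
          rintro _ ⟨w, rfl⟩
          refine Submodule.mem_iSup_of_mem
            (⟨_, eigenEnd_stable ρ N hz ξ g h.1 h.2⟩ : eigenEnd ρ N z ξ) ⟨ρ g w, ?_⟩
          simp [linHom_apply]
        exact hle hv }
  have hker : S.toSubmodule ≤ LinearMap.ker f := by
    refine iSup_le fun h => ?_
    rintro _ ⟨w, rfl⟩
    have h1 := comp_mem_eigenEnd hf h.2
    rw [hbot, Submodule.mem_bot] at h1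
    exact LinearMap.congr_fun h1 w
  rcases eq_bot_or_eq_top S with h | h
  · apply hf'0
    have h1 : S.toSubmodule = ⊥ := congrArg Subrepresentation.toSubmodule h
    have h2 := le_iSup (fun h : eigenEnd ρ N z ξ => LinearMap.range h.1) ⟨f', hf'⟩
    exact LinearMap.range_eq_bot.1 (le_bot_iff.1 (h2.trans h1.le))
  · apply hf0
    have h1 : S.toSubmodule = ⊤ := congrArg Subrepresentation.toSubmodule h
    exact LinearMap.ker_eq_top.1 (top_le_iff.1 (h1 ▸ hker))

theorem eigenEnd_pow_ne_bot {ρ : Representation ℂ G V} [IsIrreducible ρ] {N : Subgroup G}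
    [N.Normal] {z : G} (hz : ∀ g, ∃ x ∈ N, z * g = g * z * x) {ζ : ℂ}
    (hζ : eigenEnd ρ N z ζ ≠ ⊥) (k : ℕ) : eigenEnd ρ N z (ζ ^ (k + 1)) ≠ ⊥ := by
  induction k with
  | zero => simpa using hζ
  | succ k ih =>
    rw [pow_succ]
    exact eigenEnd_mul_ne_bot hz ih hζ

variable [FiniteDimensional ℂ V]

/-- If `z ^ p ∈ N` and `z` does not fix every `N`-fixed endomorphism, then `z` has an eigenvalue on
the `N`-fixed endomorphisms that is a nontrivial `p`-th root of unity. -/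
theorem exists_eigenEnd_ne_bot (ρ : Representation ℂ G V) {N : Subgroup G} [N.Normal] {z : G}
    {p : ℕ} (hp : p ≠ 0) (hzp : z ^ p ∈ N) {f : V →ₗ[ℂ] V} (hf : f ∈ fixedEnd ρ N)
    (hfz : linHom ρ ρ z f ≠ f) :
    ∃ ζ : ℂ, ζ ≠ 1 ∧ ζ ^ p = 1 ∧ eigenEnd ρ N z ζ ≠ ⊥ := by
  let A : Module.End ℂ (V →ₗ[ℂ] V) := linHom ρ ρ z
  let Q := (fixedEnd ρ N).map (A - 1)
  have hAQ : ∀ y ∈ Q, A y ∈ Q := by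
    rintro _ ⟨x, hx, rfl⟩
    exact ⟨A x, fixedEnd_stable ρ N z hx, by simp⟩
  have hQ : Nontrivial Q := by
    refine Submodule.nontrivial_iff_ne_bot.2 fun h => hfz ?_
    have h1 : (A - 1) f ∈ Q := ⟨f, hf, rfl⟩
    rw [h, Submodule.mem_bot] at h1
    exact sub_eq_zero.1 h1
  obtain ⟨ζ, hζ⟩ := Module.End.exists_eigenvalue (A.restrict hAQ)
  obtain ⟨⟨y, hyQ⟩, hy⟩ := hζ.exists_hasEigenvector
  have hy0 : y ≠ 0 := fun h => hy.2 (Subtype.ext h)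
  have hAy : A y = ζ • y := congrArg Subtype.val hy.apply_eq_smul
  have hpow : ∀ k : ℕ, (A ^ k) y = ζ ^ k • y := by
    intro k
    induction k with
    | zero => simp
    | succ k ih => rw [pow_succ', Module.End.mul_apply, ih, map_smul, hAy, smul_smul, pow_succ]
  have hsum : ∑ k ∈ Finset.range p, ζ ^ k = 0 := by
    obtain ⟨x, hx, rfl⟩ := hyQ
    have h1 : (∑ k ∈ Finset.range p, A ^ k) ((A - 1) x) = 0 := by
      rw [← Module.End.mul_apply, geom_sum_mul, LinearMap.sub_apply, sub_eq_zero,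
        ← map_pow]
      exact mem_fixedEnd.1 hx _ hzp
    rw [LinearMap.sum_apply, Finset.sum_congr rfl fun k _ => hpow k, ← Finset.sum_smul] at h1
    exact (smul_eq_zero.1 h1).resolve_right hy0
  refine ⟨ζ, ?_, ?_, ?_⟩
  · rintro rfl
    simp [hp] at hsum
  · have := geom_sum_mul ζ p
    rw [hsum, zero_mul] at this
    exact sub_eq_zero.1 this.symm
  · refine Submodule.ne_bot_iff _ |>.2 ⟨y, mem_eigenEnd.2 ⟨?_, hAy⟩, hy0⟩
    obtain ⟨x, hx, rfl⟩ := hyQ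
    exact mem_fixedEnd.1 (sub_mem (fixedEnd_stable ρ N z hx) hx)

variable [Finite G]

/-- Each nonzero eigenspace on `End V` contributes an irreducible constituent. -/
theorem exists_constituent (ρ : Representation ℂ G V) {N : Subgroup G} [N.Normal] {z : G}
    (hz : ∀ g, ∃ x ∈ N, z * g = g * z * x) {ζ : ℂ} (hζ : eigenEnd ρ N z ζ ≠ ⊥) :
    ∃ θ ∈ constituents G (ρ.character * conjChar ρ.character),
      (∀ x ∈ N, θ x = θ 1) ∧ θ z = ζ * θ 1 ∧ θ 1 ≠ 0 := by
  obtain ⟨U, hUE, hU0, hU⟩ := exists_irreducible_le (linHom ρ ρ) _ hζ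
    (eigenEnd_stable ρ N hz ζ)
  have hscalar : ∀ (g : G) (c : ℂ), (∀ f ∈ U.toSubmodule, linHom ρ ρ g f = c • f) →
      U.toRepresentation.character g = c * U.toRepresentation.character 1 := by
    intro g c h
    have h1 : U.toRepresentation g = c • LinearMap.id :=
      LinearMap.ext fun f => Subtype.ext (h f.1 f.2)
    rw [char_one, Representation.character, h1, map_smul, LinearMap.trace_id, smul_eq_mul]
  refine ⟨U.toRepresentation.character, ⟨⟨FDRep.of U.toRepresentation,
    simple_of_isIrreducible _, rfl⟩, ?_⟩, fun x hx => ?_, ?_, ?_⟩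
  · have h : ρ.character * conjChar ρ.character = (linHom ρ ρ).character := by
      ext g
      simp [char_linHom, character_inv, conjChar, mul_comm]
    rw [h]
    exact charInner_ne_zero _ _ _ (inclusion_ne_zero U hU0)
  · rw [hscalar x 1 fun f hf => by rw [one_smul]; exact (mem_eigenEnd.1 (hUE hf)).1 x hx,
      one_mul]
  · exact hscalar z ζ fun f hf => (mem_eigenEnd.1 (hUE hf)).2
  · have := Submodule.nontrivial_iff_ne_bot.2 hU0
    rw [char_one, Nat.cast_ne_zero]
    exact finrank_pos.ne'

theorem card_mul_finrank_fixedEnd (ρ : Representation ℂ G V) (N : Subgroup G) :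
    (Nat.card N * finrank ℂ (fixedEnd ρ N) : ℝ) =
      ∑ᶠ x : G, if x ∈ N then ‖ρ.character x‖ ^ 2 else 0 := by
  have := Fintype.ofFinite G
  have : Invertible (Nat.card N : ℂ) :=
    invertibleOfNonzero (Nat.cast_ne_zero.2 Nat.card_pos.ne')
  have h := card_inv_mul_sum_char_eq_finrank ((linHom ρ ρ).comp N.subtype)
  rw [inv_mul_eq_iff_eq_mul₀ (Nat.cast_ne_zero.2 Nat.card_pos.ne')] at h
  have h1 : ∀ x : N, Representation.character ((linHom ρ ρ).comp N.subtype) x =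
      ((‖ρ.character x‖ ^ 2 : ℝ) : ℂ) := fun x => by
    rw [Complex.ofReal_pow, ← Complex.conj_mul', ← character_inv]
    exact char_linHom ρ ρ x
  rw [Finset.sum_congr rfl fun x _ => h1 x, ← Complex.ofReal_sum] at h
  rw [finsum_eq_sum_of_fintype, ← Finset.sum_filter, ← Finset.sum_subtype_eq_sum_filter]
  have h2 : (Nat.card N * finrank ℂ (fixedEnd ρ N) : ℝ) =
      ∑ x : N, ‖ρ.character x‖ ^ 2 := by
    apply Complex.ofReal_injective
    rw [h]
    push_cast
    rfl
  rw [h2]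
  exact Finset.sum_bij (fun x _ => x) (by simp) (by simp) (by simp) (by simp)

theorem finrank_fixedEnd_le (ρ : Representation ℂ G V) {N M : Subgroup G} (hNM : N ≤ M) :
    Nat.card N * finrank ℂ (fixedEnd ρ N) ≤ Nat.card M * finrank ℂ (fixedEnd ρ M) := by
  have := Fintype.ofFinite G
  have h : (Nat.card N * finrank ℂ (fixedEnd ρ N) : ℝ) ≤
      Nat.card M * finrank ℂ (fixedEnd ρ M) := by
    rw [card_mul_finrank_fixedEnd, card_mul_finrank_fixedEnd, finsum_eq_sum_of_fintype,
      finsum_eq_sum_of_fintype]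
    refine Finset.sum_le_sum fun x _ => ?_
    split_ifs with h1 h2 h2
    · exact le_rfl
    · exact absurd (hNM h1) h2
    · positivity
    · exact le_rfl
  exact_mod_cast h

omit [Finite G] in
theorem finrank_fixedEnd_top (ρ : Representation ℂ G V) [IsIrreducible ρ] :
    finrank ℂ (fixedEnd ρ ⊤) = 1 := by
  rw [← IsIrreducible.finrank_intertwiningMap_self ρ,
    ← (invariantsEquivIntertwiningMap ρ ρ).finrank_eq]
  have : fixedEnd ρ ⊤ = (linHom ρ ρ).invariants := by
    ext f
    simp [mem_fixedEnd, mem_invariants]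
  rw [this]

omit [FiniteDimensional ℂ V] [Finite G] in
theorem one_mem_fixedEnd (ρ : Representation ℂ G V) (N : Subgroup G) :
    (1 : V →ₗ[ℂ] V) ∈ fixedEnd ρ N := by
  rw [mem_fixedEnd]
  intro x _
  ext v
  simp [linHom_apply]

/-- The constituents of `χ χ̄` whose kernel contains `N`. -/
def constituentsOver (ρ : Representation ℂ G V) (N : Subgroup G) : Set (G → ℂ) :=
  {θ ∈ constituents G (ρ.character * conjChar ρ.character) | ∀ x ∈ N, θ x = θ 1}

omit [FiniteDimensional ℂ V] in
theorem finite_constituentsOver (ρ : Representation ℂ G V) (N : Subgroup G) :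
    (constituentsOver ρ N).Finite :=
  (finite_isIrrChar G).subset fun _ h => h.1.1

theorem le_ncard_constituentsOver {p : ℕ} (hp : p.Prime) (hG : IsPGroup p G)
    (ρ : Representation ℂ G V) [IsIrreducible ρ] (N : Subgroup G) (hN : N.Normal) (k : ℕ)
    (hk : p ^ k ≤ finrank ℂ (fixedEnd ρ N)) :
    k * (p - 1) + 1 ≤ (constituentsOver ρ N).ncard := by
  induction N using (wellFounded_gt (α := Subgroup G)).induction generalizing k with
  | _ N ih =>
  by_cases hNtop : N = ⊤
  · subst hNtop
    rw [finrank_fixedEnd_top] at hk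
    have hk0 : k = 0 := by
      by_contra h
      exact absurd hk (Nat.one_lt_pow h hp.one_lt).not_ge
    subst hk0
    rw [zero_mul, zero_add, Nat.one_le_iff_ne_zero, ← Nat.pos_iff_ne_zero,
      Set.ncard_pos (finite_constituentsOver ρ ⊤)]
    have hnt : Nontrivial V := by
      by_contra h
      rw [not_nontrivial_iff_subsingleton] at h
      exact bot_ne_top (Subrepresentation.toSubmodule_injective
        (Subsingleton.elim _ _ : (⊥ : Subrepresentation ρ).toSubmodule = _))
    obtain ⟨θ, h1, h2, -⟩ := exists_constituent ρ (N := ⊤) (z := 1) (ζ := 1)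
      (fun g => ⟨1, trivial, by simp⟩) (Submodule.ne_bot_iff _ |>.2
        ⟨1, mem_eigenEnd.2 ⟨mem_fixedEnd.1 (one_mem_fixedEnd ρ _), by simp⟩, one_ne_zero⟩)
    exact ⟨θ, h1, h2⟩
  obtain ⟨M, z, hM, hlt, hcard, hzM, hzp, hgen, hz⟩ := exists_central_extension hp hG N hNtop
  have hsub : constituentsOver ρ M ⊆ constituentsOver ρ N :=
    fun θ h => ⟨h.1, fun x hx => h.2 x (hlt.le hx)⟩
  by_cases hact : ∃ f ∈ fixedEnd ρ N, linHom ρ ρ z f ≠ f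
  · obtain ⟨f, hf, hfz⟩ := hact
    obtain ⟨ζ, hζ1, hζp, hζ⟩ := exists_eigenEnd_ne_bot ρ hp.ne_zero hzp hf hfz
    have hprim : IsPrimitiveRoot ζ p :=
      IsPrimitiveRoot.iff_orderOf.2 (orderOf_eq_prime hζp hζ1 (hp := ⟨hp⟩))
    choose θ hθ hθN hθz hθ1 using fun j : ℕ =>
      exists_constituent ρ hz (eigenEnd_pow_ne_bot hz hζ j)
    have hinj : Set.InjOn θ (Finset.range (p - 1)) := by
      intro i hi j hj hij
      have h1 := hθz i
      rw [hij, hθz j] at h1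
      have h2 := mul_right_cancel₀ (hθ1 j) h1
      simp only [Finset.coe_range, Set.mem_Iio] at hi hj
      have := hprim.pow_inj (by omega) (by omega) h2
      omega
    have hdisj : Disjoint (constituentsOver ρ M) (θ '' (Finset.range (p - 1))) := by
      rw [Set.disjoint_left]
      rintro _ h ⟨j, hj, rfl⟩
      have h1 := hθz j
      rw [h.2 z hzM] at h1
      have h2 := (mul_eq_right₀ (hθ1 j)).1 h1.symm
      simp only [Finset.coe_range, Set.mem_Iio] at hj
      exact hprim.pow_ne_one_of_pos_of_lt (by omega) (by omega) h2
    have hcount : (constituentsOver ρ M).ncard + (p - 1) ≤ (constituentsOver ρ N).ncard := by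
      have h1 : (θ '' (Finset.range (p - 1))).ncard = p - 1 := by
        rw [hinj.ncard_image, Set.ncard_coe_finset, Finset.card_range]
      rw [← h1, ← Set.ncard_union_eq hdisj (finite_constituentsOver ρ M)
        ((Finset.finite_toSet _).image _)]
      refine Set.ncard_le_ncard (Set.union_subset hsub ?_) (finite_constituentsOver ρ N)
      rintro _ ⟨j, -, rfl⟩
      exact ⟨hθ j, hθN j⟩
    cases k with
    | zero =>
      have := ih M hlt hM 0 (by
        rw [pow_zero, Nat.one_le_iff_ne_zero]
        intro h
        rw [pow_zero] at hk
        have h1 := finrank_fixedEnd_le ρ hlt.le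
        rw [h, mul_zero, Nat.le_zero, mul_eq_zero] at h1
        have h2 : 0 < Nat.card N := Nat.card_pos
        omega)
      omega
    | succ k =>
      have h1 := finrank_fixedEnd_le ρ hlt.le
      rw [hcard, mul_assoc, mul_left_comm] at h1
      have h2 := Nat.le_of_mul_le_mul_left h1 Nat.card_pos
      have h3 : p * p ^ k ≤ p * finrank ℂ (fixedEnd ρ M) := by
        rw [← pow_succ']
        exact hk.trans h2
      have h4 := ih M hlt hM k (Nat.le_of_mul_le_mul_left h3 hp.pos)
      rw [add_mul, one_mul]
      omega
  · push Not at hact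
    have heq : fixedEnd ρ N ≤ fixedEnd ρ M := by
      intro f hf
      rw [mem_fixedEnd]
      intro m hm
      obtain ⟨j, x, hx, rfl⟩ := hgen m hm
      rw [map_mul, Module.End.mul_apply, mem_fixedEnd.1 hf x hx]
      clear hm
      induction j with
      | zero => simp
      | succ j ih => rw [pow_succ, map_mul, Module.End.mul_apply, hact f hf, ih]
    exact (ih M hlt hM k (hk.trans (Submodule.finrank_mono heq))).trans
      (Set.ncard_le_ncard hsub (finite_constituentsOver ρ N))

end Levels

end CharProduct

/-- **Theorem A.** Let `p` be a prime, `G` a finite `p`-group, and `χ ∈ Irr(G)` with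
`χ(1) = p ^ n`. Then `η(χ, χ̄) ≥ 2n(p-1) + 1`. -/
theorem products_of_characters_theorem_A {p n : ℕ} (hp : p.Prime)
    (G : Type) [Group G] [Finite G] (hG : IsPGroup p G)
    (χ : G → ℂ) (hχ : IsIrrChar G χ) (hdeg : χ 1 = (p : ℂ) ^ n) :
    2 * n * (p - 1) + 1 ≤ eta G χ (conjChar χ) := by
  obtain ⟨V, hV, rfl⟩ := hχ
  have := CharProduct.isIrreducible_of_simple V
  have hdim : Module.finrank ℂ V = p ^ n := by
    rw [FDRep.char_one] at hdeg
    exact_mod_cast hdeg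
  have hbot : CharProduct.fixedEnd V.ρ ⊥ = ⊤ := by
    refine eq_top_iff.2 fun f _ => CharProduct.mem_fixedEnd.2 fun x hx => ?_
    rw [Subgroup.mem_bot.1 hx, map_one, Module.End.one_apply]
  have h := CharProduct.le_ncard_constituentsOver hp hG V.ρ ⊥ inferInstance (2 * n) (by
    rw [hbot, finrank_top, Module.finrank_linearMap, hdim, ← pow_add, two_mul])
  exact h.trans (Set.ncard_le_ncard (fun θ h => h.1)
    ((CharProduct.finite_isIrrChar G).subset fun _ h => h.1))
end

section
/- Let p be a prime number, G a finite p-group, and χ an irreducible complex character of G. Then exactly one of the following holds: (i) χ(1) = 1 and η(χ, χ̄) = 1; (ii) χ(1) = p and η(χ, χ̄) = 2p−1 or η(χ, χ̄) = p²; (iii) χ(1) ≥ p² and η(χ, χ̄) ≥ 4p−3. -/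
open scoped Classical

namespace Representation

open Module

section Character

variable {G V : Type*} [Group G] [Finite G] [AddCommGroup V] [Module ℂ V] [FiniteDimensional ℂ V]

theorem iSup_eigenspace_eq_top_of_finite (ρ : Representation ℂ G V) (g : G) :
    ⨆ μ, End.eigenspace (ρ g) μ = ⊤ := by
  have hss : End.IsSemisimple (ρ g) := by
    refine End.isSemisimple_of_squarefree_aeval_eq_zero
      (p := Polynomial.X ^ Nat.card G - 1) ?_ ?_
    · exact (Polynomial.X_pow_sub_one_separable_iff.mpr
        (Nat.cast_ne_zero.mpr Nat.card_pos.ne')).squarefree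
    · rw [map_sub, map_pow, Polynomial.aeval_X, ← map_pow, pow_card_eq_one', map_one, map_one,
        sub_self]
  simpa only [hss.isFinitelySemisimple.maxGenEigenspace_eq_eigenspace] using
    End.iSup_maxGenEigenspace_eq_top (ρ g)

theorem character_inv (ρ : Representation ℂ G V) (g : G) :
    ρ.character g⁻¹ = starRingEnd ℂ (ρ.character g) := by
  have hint : DirectSum.IsInternal (End.eigenspace (ρ g)) :=
    DirectSum.isInternal_submodule_of_iSupIndep_of_iSup_eq_top
      (End.eigenspaces_iSupIndep _) (iSup_eigenspace_eq_top_of_finite ρ g)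
  have hfin : {μ | End.eigenspace (ρ g) μ ≠ ⊥}.Finite :=
    WellFoundedGT.finite_ne_bot_of_iSupIndep hint.submodule_iSupIndep
  have hact : ∀ μ, ∀ v ∈ End.eigenspace (ρ g) μ, ρ g⁻¹ v = μ⁻¹ • v := by
    intro μ v hv
    rw [End.mem_eigenspace_iff] at hv
    by_cases hv0 : v = 0
    · simp [hv0]
    have hinv : ρ g⁻¹ (ρ g v) = v := by simp
    have hμ : μ ≠ 0 := by
      rintro rfl
      rw [hv] at hinv
      simp at hinv
      exact hv0 hinv.symm
    rw [hv, map_smul] at hinv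
    rw [← hinv, smul_smul, inv_mul_cancel₀ hμ, one_smul, hinv]
  have hm : ∀ μ, Set.MapsTo (ρ g) (End.eigenspace (ρ g) μ) (End.eigenspace (ρ g) μ) := by
    intro μ v hv
    rw [SetLike.mem_coe] at hv ⊢
    rw [End.mem_eigenspace_iff.mp hv]
    exact Submodule.smul_mem _ _ hv
  have hm' : ∀ μ, Set.MapsTo (ρ g⁻¹) (End.eigenspace (ρ g) μ) (End.eigenspace (ρ g) μ) := by
    intro μ v hv
    rw [SetLike.mem_coe] at hv ⊢
    rw [hact μ v hv]
    exact Submodule.smul_mem _ _ hv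
  rw [character, character, LinearMap.trace_eq_sum_trace_restrict' hint hfin hm',
    LinearMap.trace_eq_sum_trace_restrict' hint hfin hm, map_sum]
  refine Finset.sum_congr rfl fun μ hμ => ?_
  have h1 : (ρ g).restrict (hm μ) = μ • LinearMap.id := by
    ext ⟨v, hv⟩
    exact End.mem_eigenspace_iff.mp hv
  have h2 : (ρ g⁻¹).restrict (hm' μ) = μ⁻¹ • LinearMap.id := by
    ext ⟨v, hv⟩
    exact hact μ v hv
  have hnorm : ‖μ‖ = 1 := by
    rw [Set.Finite.mem_toFinset] at hμ
    obtain ⟨v, hv, hv0⟩ := Submodule.exists_mem_ne_zero_of_ne_bot hμ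
    rw [End.mem_eigenspace_iff] at hv
    have hpow : ∀ n : ℕ, (ρ g ^ n) v = μ ^ n • v := by
      intro n
      induction n with
      | zero => simp
      | succ n ih => rw [pow_succ', Module.End.mul_apply, ih, map_smul, hv, smul_smul, pow_succ]
    have := hpow (Nat.card G)
    rw [← map_pow, pow_card_eq_one', map_one, Module.End.one_apply] at this
    refine Complex.norm_eq_one_of_pow_eq_one (n := Nat.card G) ?_ Nat.card_pos.ne'
    have h3 : (μ ^ Nat.card G - 1) • v = 0 := by rw [sub_smul, ← this]; simp
    exact sub_eq_zero.mp ((smul_eq_zero.mp h3).resolve_right hv0)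
  rw [h1, h2, map_smul, map_smul, smul_eq_mul, smul_eq_mul, map_mul, ← Complex.inv_eq_conj hnorm]
  simp

omit [Finite G] [FiniteDimensional ℂ V] in
theorem isIrreducible_toRepresentation_of_isAtom {ρ : Representation ℂ G V}
    {S : Subrepresentation ρ} (hS : IsAtom S) : IsIrreducible S.toRepresentation where
  exists_pair_ne := by
    refine ⟨⊥, ⊤, fun h => hS.1 ?_⟩
    have h' := congrArg Subrepresentation.toSubmodule h
    have h'' : (⊥ : Submodule ℂ S.toSubmodule) = ⊤ := h'
    apply Subrepresentation.toSubmodule_injective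
    change S.toSubmodule = ⊥
    exact (Submodule.eq_bot_iff _).mpr fun x hx => by
      have : (⟨x, hx⟩ : S.toSubmodule) ∈ (⊤ : Submodule ℂ S.toSubmodule) := Submodule.mem_top
      rw [← h''] at this
      exact congrArg Subtype.val ((Submodule.mem_bot ℂ).mp this)
  eq_bot_or_eq_top T := by
    let T' : Subrepresentation ρ :=
      { toSubmodule := T.toSubmodule.map S.toSubmodule.subtype
        apply_mem_toSubmodule := by
          rintro g _ ⟨v, hv, rfl⟩
          exact ⟨S.toRepresentation g v, T.apply_mem_toSubmodule g hv, rfl⟩ }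
    have hle : T' ≤ S := by
      rintro _ ⟨v, hv, rfl⟩
      exact v.2
    rcases hS.le_iff.mp hle with h | h
    · left
      apply Subrepresentation.toSubmodule_injective
      have h' : T.toSubmodule.map S.toSubmodule.subtype = ⊥ :=
        congrArg Subrepresentation.toSubmodule h
      refine (Submodule.eq_bot_iff _).mpr fun x hx => ?_
      have hx' : (x : V) ∈ T.toSubmodule.map S.toSubmodule.subtype := ⟨x, hx, rfl⟩
      rw [h', Submodule.mem_bot] at hx'
      exact Subtype.ext hx'
    · right
      apply Subrepresentation.toSubmodule_injective
      change T.toSubmodule = ⊤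
      rw [Submodule.eq_top_iff']
      intro x
      have hx : (x : V) ∈ T' := by rw [h]; exact x.2
      obtain ⟨y, hy, hxy⟩ := hx
      rwa [← S.toSubmodule.injective_subtype hxy]

theorem exists_character_eq_sum_irreducible (ρ : Representation ℂ G V) :
    ∃ s : Finset (Subrepresentation ρ), (∀ S ∈ s, IsIrreducible S.toRepresentation) ∧
      ρ.character = ∑ S ∈ s, S.toRepresentation.character := by
  obtain ⟨s, hind, hsup, hsimple⟩ :=
    IsSemisimpleModule.exists_sSupIndep_sSup_simples_eq_top (MonoidAlgebra ℂ G) ρ.asModule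
  let N : s → Submodule ℂ V := fun i => (Subrepresentation.ofSubmodule' i.1).toSubmodule
  have hint : DirectSum.IsInternal (fun i : s => i.1) :=
    DirectSum.isInternal_submodule_of_iSupIndep_of_iSup_eq_top
      ((sSupIndep_iff _).mp hind) (by rw [← hsup, sSup_eq_iSup'])
  have hint' : DirectSum.IsInternal N := hint
  have hne : ∀ i : s, N i ≠ ⊥ := by
    rintro ⟨i, hi⟩ h
    have := hsimple i hi
    have hb := (Submodule.nontrivial_iff_ne_bot).mp (IsSimpleModule.nontrivial (MonoidAlgebra ℂ G) i)
    exact hb ((Submodule.eq_bot_iff _).mpr fun x hx => (Submodule.eq_bot_iff _).mp h x hx)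
  have hfin : Finite s :=
    WellFoundedGT.finite_of_iSupIndep hint'.submodule_iSupIndep hne
  have : Fintype s := Fintype.ofFinite s
  refine ⟨(Finset.univ : Finset s).map
    ⟨fun i => Subrepresentation.ofSubmodule' i.1, fun i j h => Subtype.ext ?_⟩, ?_, ?_⟩
  · exact Subrepresentation.subrepresentationSubmoduleOrderIso.symm.injective h
  · intro S hS
    obtain ⟨i, -, rfl⟩ := Finset.mem_map.mp hS
    refine isIrreducible_toRepresentation_of_isAtom ?_
    rw [← Subrepresentation.subrepresentationSubmoduleOrderIso.isAtom_iff]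
    exact isSimpleModule_iff_isAtom.mp (hsimple i.1 i.2)
  · ext g
    rw [Finset.sum_map, Finset.sum_apply]
    exact LinearMap.trace_eq_sum_trace_restrict hint'
      (fun i => (Subrepresentation.ofSubmodule' i.1).apply_mem_toSubmodule g)

omit [Finite G] [FiniteDimensional ℂ V] in
theorem IsIrreducible.exists_ne_zero {ρ : Representation ℂ G V} (hρ : IsIrreducible ρ) :
    ∃ v : V, v ≠ 0 := by
  by_contra! h
  obtain ⟨a, b, hab⟩ := hρ.exists_pair_ne
  refine hab (SetLike.ext fun v => ?_)
  rw [h v]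
  exact iff_of_true a.toSubmodule.zero_mem b.toSubmodule.zero_mem

omit [FiniteDimensional ℂ V] in
theorem isIrreducible_of_finrank_intertwiningMap (ρ : Representation ℂ G V)
    (h : finrank ℂ (IntertwiningMap ρ ρ) = 1) : IsIrreducible ρ where
  exists_pair_ne := by
    have hne : (1 : IntertwiningMap ρ ρ) ≠ 0 := by
      intro h1
      have : Subsingleton (IntertwiningMap ρ ρ) :=
        ⟨fun a b => by rw [← mul_one a, ← mul_one b, h1, mul_zero, mul_zero]⟩
      rw [finrank_zero_of_subsingleton] at h
      exact zero_ne_one h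
    refine ⟨⊥, ⊤, fun h1 => hne ?_⟩
    have h2 : (⊥ : Submodule ℂ V) = ⊤ := congrArg Subrepresentation.toSubmodule h1
    apply IntertwiningMap.ext
    ext v
    have hv : v ∈ (⊤ : Submodule ℂ V) := Submodule.mem_top
    rw [← h2, Submodule.mem_bot] at hv
    rw [hv, map_zero, map_zero]
  eq_bot_or_eq_top T := by
    obtain ⟨C, hC⟩ := exists_isCompl T
    have hC' : IsCompl T.toSubmodule C.toSubmodule := by
      refine ⟨disjoint_iff.mpr ?_, codisjoint_iff.mpr ?_⟩
      · exact congrArg Subrepresentation.toSubmodule hC.inf_eq_bot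
      · exact congrArg Subrepresentation.toSubmodule hC.sup_eq_top
    let P := T.toSubmodule.projection C.toSubmodule hC'
    have hP : ∀ g v, P (ρ g v) = ρ g (P v) := by
      intro g v
      obtain ⟨a, ha, b, hb, rfl⟩ : ∃ a ∈ T.toSubmodule, ∃ b ∈ C.toSubmodule, a + b = v := by
        rw [← Submodule.mem_sup, hC'.sup_eq_top]
        exact Submodule.mem_top
      have h1 := T.apply_mem_toSubmodule g ha
      have h2 := C.apply_mem_toSubmodule g hb
      simp only [map_add, P]
      rw [Submodule.projection_apply_of_mem_left _ h1, Submodule.projection_apply_of_mem_left _ ha,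
        (Submodule.projection_apply_eq_zero_iff _).mpr h2,
        (Submodule.projection_apply_eq_zero_iff _).mpr hb, map_zero]
    by_cases hT : T = ⊥
    · exact Or.inl hT
    right
    obtain ⟨t, ht, ht0⟩ := (Submodule.ne_bot_iff _).mp
      (fun h' => hT (Subrepresentation.toSubmodule_injective h') : T.toSubmodule ≠ ⊥)
    have hne : (1 : IntertwiningMap ρ ρ) ≠ 0 := fun h1 =>
      ht0 (congrArg (fun f : IntertwiningMap ρ ρ => f t) h1)
    obtain ⟨c, hc⟩ := (finrank_eq_one_iff_of_nonzero' _ hne).mp h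
      (P.intertwiningMap_of_isIntertwiningMap ρ ρ hP)
    have hcv : ∀ v, c • v = P v := fun v =>
      congrArg (fun f : IntertwiningMap ρ ρ => f v) hc
    have hc1 : c ≠ 0 := by
      rintro rfl
      have := hcv t
      rw [zero_smul, Submodule.projection_apply_of_mem_left _ ht] at this
      exact ht0 this.symm
    apply Subrepresentation.toSubmodule_injective
    change T.toSubmodule = ⊤
    rw [Submodule.eq_top_iff']
    intro v
    rw [← Submodule.smul_mem_iff _ hc1, hcv]
    exact Submodule.projection_apply_mem _ _

end Character

section Constituents

variable {G : Type} [Group G] [Finite G]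

theorem isIrrChar_iff_exists_isIrreducible {χ : G → ℂ} :
    IsIrrChar G χ ↔ ∃ (V : Type) (_ : AddCommGroup V) (_ : Module ℂ V) (_ : FiniteDimensional ℂ V)
      (ρ : Representation ℂ G V), IsIrreducible ρ ∧ ρ.character = χ := by
  let : Fintype G := Fintype.ofFinite G
  let : Invertible (Nat.card G : ℂ) :=
    invertibleOfNonzero (Nat.cast_ne_zero.mpr Nat.card_pos.ne')
  have hcard : (Nat.card G : ℂ) ≠ 0 := Nat.cast_ne_zero.mpr Nat.card_pos.ne'
  constructor
  · rintro ⟨V, hV, rfl⟩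
    refine ⟨V, inferInstance, inferInstance, inferInstance, V.ρ, ?_, rfl⟩
    apply isIrreducible_of_finrank_intertwiningMap
    have h := card_inv_mul_sum_char_mul_char_eq_finrank (k := ℂ) (ρ := V.ρ) (σ := V.ρ)
    rw [FDRep.simple_iff_char_is_norm_one] at hV
    erw [hV] at h
    rw [inv_mul_cancel₀ hcard] at h
    exact_mod_cast h.symm
  · rintro ⟨V, _, _, _, ρ, hρ, rfl⟩
    refine ⟨FDRep.of ρ, ?_, rfl⟩
    rw [FDRep.simple_iff_char_is_norm_one]
    have h := card_inv_mul_sum_char_mul_char_eq_finrank (k := ℂ) (ρ := ρ) (σ := ρ)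
    rw [IsIrreducible.finrank_intertwiningMap_self] at h
    rw [inv_mul_eq_iff_eq_mul₀ hcard] at h
    rw [Nat.cast_one, mul_one] at h
    exact h

variable {V W : Type} [AddCommGroup V] [Module ℂ V] [FiniteDimensional ℂ V]
  [AddCommGroup W] [Module ℂ W] [FiniteDimensional ℂ W]

theorem charInner_character (σ : Representation ℂ G V) (τ : Representation ℂ G W) :
    charInner G σ.character τ.character = finrank ℂ (IntertwiningMap σ τ) := by
  let : Fintype G := Fintype.ofFinite G
  let : Invertible (Nat.card G : ℂ) :=
    invertibleOfNonzero (Nat.cast_ne_zero.mpr Nat.card_pos.ne')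
  rw [← card_inv_mul_sum_char_mul_char_eq_finrank, charInner, finsum_eq_sum_of_fintype,
    ← Equiv.sum_comp (Equiv.inv G)]
  congr 1
  refine Finset.sum_congr rfl fun g _ => ?_
  rw [← character_inv, Equiv.inv_apply, inv_inv, mul_comm]

theorem character_linHom_self (ρ : Representation ℂ G V) :
    (linHom ρ ρ).character = ρ.character * conjChar ρ.character := by
  ext g
  rw [char_linHom, character_inv, mul_comm]
  rfl

theorem character_mem_constituents {σ : Representation ℂ G V} (hσ : IsIrreducible σ)
    {τ : Representation ℂ G W} {f : IntertwiningMap σ τ} (hf : f ≠ 0) :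
    σ.character ∈ constituents G τ.character := by
  refine ⟨isIrrChar_iff_exists_isIrreducible.mpr ⟨V, ‹_›, ‹_›, ‹_›, σ, hσ, rfl⟩, ?_⟩
  rw [charInner_character, Nat.cast_ne_zero]
  have := Module.finrank_pos_iff_exists_ne_zero (R := ℂ) (M := IntertwiningMap σ τ)
  exact (this.mpr ⟨f, hf⟩).ne'

theorem exists_intertwiningMap_of_charInner_ne_zero {σ : Representation ℂ G V}
    {τ : Representation ℂ G W} (h : charInner G σ.character τ.character ≠ 0) :
    ∃ f : IntertwiningMap σ τ, f ≠ 0 := by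
  rw [charInner_character, Nat.cast_ne_zero] at h
  exact Module.finrank_pos_iff_exists_ne_zero.mp (Nat.pos_of_ne_zero h)

theorem exists_finset_eq_constituents (τ : Representation ℂ G W) :
    ∃ F : Finset (G → ℂ), ↑F = constituents G τ.character ∧ ∃ d : (G → ℂ) → ℕ,
      (∀ θ ∈ F, θ 1 = d θ) ∧ ∑ θ ∈ F, d θ ≤ finrank ℂ W := by
  obtain ⟨s, hs, hsum⟩ := exists_character_eq_sum_irreducible τ
  have hinner : ∀ φ : G → ℂ, charInner G φ τ.character =
      ∑ S ∈ s, charInner G φ S.toRepresentation.character := by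
    intro φ
    let : Fintype G := Fintype.ofFinite G
    simp only [hsum, charInner, finsum_eq_sum_of_fintype, Finset.sum_apply, map_sum,
      Finset.mul_sum]
    rw [Finset.sum_comm]
  have hd : ∀ S : Subrepresentation τ,
      ⌊(S.toRepresentation.character 1).re⌋₊ = finrank ℂ S.toSubmodule := by
    intro S
    rw [char_one, Complex.natCast_re, Nat.floor_natCast]
  refine ⟨s.image fun S => S.toRepresentation.character, ?_, fun θ => ⌊(θ 1).re⌋₊, ?_, ?_⟩
  · ext θ
    rw [Finset.mem_coe, Finset.mem_image]
    constructor
    · rintro ⟨S, hS, rfl⟩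
      let f : IntertwiningMap S.toRepresentation τ :=
        S.toSubmodule.subtype.intertwiningMap_of_isIntertwiningMap _ _ fun g v => rfl
      refine character_mem_constituents (hs S hS) (f := f) fun hf => ?_
      obtain ⟨v, hv⟩ := (hs S hS).exists_ne_zero
      exact hv (Subtype.ext (congrArg (fun f : IntertwiningMap S.toRepresentation τ => f v) hf))
    · rintro ⟨hθ, hne⟩
      obtain ⟨U, _, _, _, σ, hσ, rfl⟩ := isIrrChar_iff_exists_isIrreducible.mp hθ
      rw [hinner] at hne
      obtain ⟨S, hS, hne'⟩ := Finset.exists_ne_zero_of_sum_ne_zero hne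
      obtain ⟨f, hf⟩ := exists_intertwiningMap_of_charInner_ne_zero hne'
      have := hs S hS
      exact ⟨S, hS, (char_iso (f.ofBijective ((IsIrreducible.bijective_or_eq_zero f).resolve_right hf))).symm⟩
  · intro θ hθ
    obtain ⟨S, hS, rfl⟩ := Finset.mem_image.mp hθ
    dsimp only
    rw [hd, char_one]
  · have h1 := congrFun hsum 1
    rw [char_one, Finset.sum_apply] at h1
    simp only [char_one] at h1
    rw [← Nat.cast_sum, Nat.cast_inj] at h1
    rw [h1]
    simp only [← hd]
    rw [← Finset.sum_fiberwise_of_maps_to (s := s)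
      (t := s.image fun S => S.toRepresentation.character)
      (g := fun S => S.toRepresentation.character)
      fun S hS => Finset.mem_image_of_mem (fun S => S.toRepresentation.character) hS]
    refine Finset.sum_le_sum fun θ hθ => ?_
    obtain ⟨S, hS, rfl⟩ := Finset.mem_image.mp hθ
    exact Finset.single_le_sum
      (f := fun S : Subrepresentation τ => ⌊(S.toRepresentation.character 1).re⌋₊)
      (fun _ _ => Nat.zero_le _) (Finset.mem_filter.mpr ⟨hS, rfl⟩)

theorem exists_constituent_of_forall_conj (τ : Representation ℂ G W) {T : W} (hT : T ≠ 0) :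
    ∃ θ ∈ constituents G τ.character, θ 1 ≠ 0 ∧
      ∀ (h : G) (c : ℂ), (∀ g : G, τ (g * h * g⁻¹) T = c • T) → θ h = c * θ 1 := by
  let U : Subrepresentation τ :=
    { toSubmodule := Submodule.span ℂ (Set.range fun g => τ g T)
      apply_mem_toSubmodule := by
        intro g v hv
        induction hv using Submodule.span_induction with
        | mem x hx =>
          obtain ⟨y, rfl⟩ := hx
          exact Submodule.subset_span ⟨g * y, by simp⟩
        | zero => simp
        | add x y _ _ hx hy => rw [map_add]; exact add_mem hx hy
        | smul a x _ hx => rw [map_smul]; exact Submodule.smul_mem _ _ hx }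
  have hTU : T ∈ U.toSubmodule := Submodule.subset_span ⟨1, by simp⟩
  have hU : U ≠ ⊥ := by
    intro h
    have h' : U.toSubmodule = ⊥ := congrArg Subrepresentation.toSubmodule h
    rw [h', Submodule.mem_bot] at hTU
    exact hT hTU
  have : IsAtomic (Subrepresentation τ) :=
    Subrepresentation.subrepresentationSubmoduleOrderIso.isAtomic_iff.mpr
      (inferInstance : IsAtomic (Submodule (MonoidAlgebra ℂ G) τ.asModule))
  obtain ⟨S, hS, hSU⟩ := (IsAtomic.eq_bot_or_exists_atom_le U).resolve_left hU
  have hirr := isIrreducible_toRepresentation_of_isAtom hS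
  obtain ⟨v, hv⟩ := hirr.exists_ne_zero
  let f : IntertwiningMap S.toRepresentation τ :=
    S.toSubmodule.subtype.intertwiningMap_of_isIntertwiningMap _ _ fun g v => rfl
  refine ⟨S.toRepresentation.character, character_mem_constituents hirr (f := f) fun hf =>
    hv (Subtype.ext (congrArg (fun f : IntertwiningMap S.toRepresentation τ => f v) hf)), ?_, ?_⟩
  · rw [char_one, Nat.cast_ne_zero]
    exact (Module.finrank_pos_iff_exists_ne_zero.mpr ⟨v, hv⟩).ne'
  · intro h c hc
    have hUc : ∀ v ∈ U.toSubmodule, τ h v = c • v := by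
      intro v hv
      induction hv using Submodule.span_induction with
      | mem x hx =>
        obtain ⟨y, rfl⟩ := hx
        have h1 := hc y⁻¹
        rw [inv_inv] at h1
        dsimp only
        rw [← map_smul, ← h1, ← Module.End.mul_apply, ← Module.End.mul_apply, ← map_mul, ← map_mul]
        congr 2
        group
      | zero => simp
      | add x y _ _ hx hy => rw [map_add, hx, hy, smul_add]
      | smul a x _ hx => rw [map_smul, hx, smul_comm]
    have hres : S.toRepresentation h = c • LinearMap.id := by
      ext x
      exact hUc x (hSU x.2)
    rw [char_one, character, hres, map_smul, LinearMap.trace_id, smul_eq_mul]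

theorem exists_eigenvector_of_constituent_degree_one (τ : Representation ℂ G W) {θ : G → ℂ}
    (hθ : θ ∈ constituents G τ.character) (h1 : θ 1 = 1) :
    ∃ T : W, T ≠ 0 ∧ ∀ g, τ g T = θ g • T := by
  obtain ⟨hirr, hne⟩ := hθ
  obtain ⟨U, _, _, _, σ, hσ, rfl⟩ := isIrrChar_iff_exists_isIrreducible.mp hirr
  obtain ⟨f, hf⟩ := exists_intertwiningMap_of_charInner_ne_zero hne
  rw [char_one, Nat.cast_eq_one] at h1
  obtain ⟨v, hv⟩ := hσ.exists_ne_zero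
  have hact : ∀ g, ∀ w, σ g w = σ.character g • w := by
    intro g
    obtain ⟨c, hc⟩ := (finrank_eq_one_iff_of_nonzero' v hv).mp h1 (σ g v)
    have hlin : σ g = c • LinearMap.id := by
      ext w
      obtain ⟨a, rfl⟩ := (finrank_eq_one_iff_of_nonzero' v hv).mp h1 w
      rw [map_smul, ← hc, LinearMap.smul_apply, LinearMap.id_apply, smul_comm]
    intro w
    rw [character, hlin, map_smul, LinearMap.trace_id, h1]
    simp
  have hinj : Function.Injective f := (IsIrreducible.injective_or_eq_zero f).resolve_right hf
  refine ⟨f v, fun h => hv (hinj (h.trans (map_zero f).symm)), fun g => ?_⟩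
  rw [← f.isIntertwining, hact, map_smul]

end Constituents

end Representation

namespace IsPGroup

variable {p : ℕ} {G : Type*} [Group G] [Finite G]

theorem exists_mem_center_of_normal (hp : p.Prime) (hG : IsPGroup p G) (N : Subgroup G)
    [N.Normal] (hN : N ≠ ⊥) : ∃ k ∈ N, k ≠ 1 ∧ k ∈ Subgroup.center G := by
  have : Fact p.Prime := ⟨hp⟩
  let : MulAction G N := MulAction.compHom N (MulAut.conjNormal : G →* MulAut N)
  have hdvd : p ∣ Nat.card N := by
    obtain ⟨n, hn⟩ := (hG.to_subgroup N).exists_card_eq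
    rw [hn]
    refine dvd_pow_self p ?_
    rintro rfl
    exact hN (Subgroup.card_eq_one.mp hn)
  have hone : (1 : N) ∈ MulAction.fixedPoints G N := fun g =>
    map_one (MulAut.conjNormal g : MulAut N)
  obtain ⟨b, hb, hne⟩ := hG.exists_fixed_point_of_prime_dvd_card_of_fixed_point N hdvd hone
  refine ⟨b, b.2, fun h => hne (Subtype.ext h.symm), ?_⟩
  rw [Subgroup.mem_center_iff]
  intro g
  have h : g * b * g⁻¹ = b := by
    rw [← MulAut.conjNormal_apply]
    exact congrArg Subtype.val (hb g)
  exact mul_inv_eq_iff_eq_mul.mp h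

theorem exists_commutator_mem_pow_mem (hp : p.Prime) (hG : IsPGroup p G) {L M : Subgroup G}
    [L.Normal] [M.Normal] (hLM : L < M) :
    ∃ k ∈ M, k ∉ L ∧ (∀ g, g * k * g⁻¹ * k⁻¹ ∈ L) ∧ k ^ p ∈ L := by
  obtain ⟨m, hm, hmL⟩ := SetLike.exists_of_lt hLM
  have hN : M.map (QuotientGroup.mk' L) ≠ ⊥ := by
    intro h
    rw [Subgroup.map_eq_bot_iff, QuotientGroup.ker_mk'] at h
    exact hmL (h hm)
  obtain ⟨_, ⟨k, hk, rfl⟩, hne, hc⟩ :=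
    exists_mem_center_of_normal hp (hG.to_quotient L) (M.map (QuotientGroup.mk' L)) hN
  obtain ⟨n, hn⟩ := hG k
  have hex : ∃ i, k ^ p ^ i ∈ L := ⟨n, hn ▸ L.one_mem⟩
  have hkL : k ∉ L := fun h => hne ((QuotientGroup.eq_one_iff k).mpr h)
  have hfind := Nat.find_spec hex
  obtain ⟨i, hi⟩ : ∃ i, Nat.find hex = i + 1 :=
    Nat.exists_eq_succ_of_ne_zero fun h => hkL (by simpa [h] using hfind)
  refine ⟨k ^ p ^ i, M.pow_mem hk _, Nat.find_min hex (by omega), fun g => ?_, ?_⟩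
  · have h := Subgroup.mem_center_iff.mp (Subgroup.pow_mem _ hc (p ^ i)) (QuotientGroup.mk' L g)
    rw [← QuotientGroup.eq_one_iff]
    change QuotientGroup.mk' L (g * k ^ p ^ i * g⁻¹ * (k ^ p ^ i)⁻¹) = 1
    simp only [map_mul, map_inv, map_pow] at h ⊢
    rw [h]
    group
  · rw [hi] at hfind
    rwa [← pow_mul, ← pow_succ]

end IsPGroup

theorem Set.ncard_add_le_of_isPrimitiveRoot {α : Type*} {C : Set (α → ℂ)} (hC : C.Finite)
    {p : ℕ} {ω : ℂ} (hω : IsPrimitiveRoot ω p) (e h : α)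
    (H : ∀ j, 0 < j → j < p → ∃ θ ∈ C, θ e ≠ 0 ∧ θ h = ω ^ j * θ e) :
    {θ ∈ C | θ h = θ e}.ncard + (p - 1) ≤ C.ncard := by
  choose! f hfC hfe hfh using H
  have hinj : Set.InjOn f (Set.Ioo 0 p) := by
    rintro i ⟨hi0, hip⟩ j ⟨hj0, hjp⟩ hij
    have h1 := hfh i hi0 hip
    rw [hij, hfh j hj0 hjp] at h1
    exact (hω.pow_inj hjp hip (mul_right_cancel₀ (hfe j hj0 hjp) h1)).symm
  have hcard : (f '' Set.Ioo 0 p).ncard = p - 1 := by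
    rw [hinj.ncard_image, Set.ncard_eq_toFinset_card']
    simp
  have hdisj : Disjoint {θ ∈ C | θ h = θ e} (f '' Set.Ioo 0 p) := by
    rw [Set.disjoint_left]
    rintro _ ⟨-, h1⟩ ⟨j, ⟨hj0, hjp⟩, rfl⟩
    rw [hfh j hj0 hjp] at h1
    have h2 : ω ^ j = 1 := mul_right_cancel₀ (hfe j hj0 hjp) (h1.trans (one_mul _).symm)
    exact hω.pow_ne_one_of_pos_of_lt hj0.ne' hjp h2
  rw [← hcard, ← Set.ncard_union_eq hdisj (hC.subset (Set.sep_subset _ _))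
    ((Set.finite_Ioo 0 p).image f)]
  refine Set.ncard_le_ncard (Set.union_subset (Set.sep_subset _ _) ?_) hC
  rintro _ ⟨j, ⟨hj0, hjp⟩, rfl⟩
  exact hfC j hj0 hjp

namespace Representation

open Module

variable {G V : Type*} [Group G] [AddCommGroup V] [Module ℂ V]

/-- The elements of `G` acting as a scalar on the range of `P`. -/
def scalarStabilizer (ρ : Representation ℂ G V) (P : End ℂ V) : Subgroup G where
  carrier := {g | ∃ c : ℂ, ρ g * P = c • P}
  one_mem' := ⟨1, by rw [map_one, one_mul, one_smul]⟩
  mul_mem' := by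
    rintro g h ⟨c, hc⟩ ⟨d, hd⟩
    exact ⟨d * c, by rw [map_mul, mul_assoc, hd, mul_smul_comm, hc, smul_smul]⟩
  inv_mem' := by
    rintro g ⟨c, hc⟩
    refine ⟨c⁻¹, ?_⟩
    have h : P = c • (ρ g⁻¹ * P) := by
      rw [← mul_smul_comm, ← hc, ← mul_assoc, ← map_mul, inv_mul_cancel, map_one, one_mul]
    rcases eq_or_ne c 0 with rfl | hne
    · rw [zero_smul] at h
      rw [h, mul_zero, smul_zero]
    · conv_rhs => rw [h, smul_smul, inv_mul_cancel₀ hne, one_smul]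

theorem mul_inv_cancel_apply (ρ : Representation ℂ G V) (g : G) : ρ g * ρ g⁻¹ = 1 := by
  rw [← map_mul, mul_inv_cancel, map_one]

theorem inv_mul_cancel_apply (ρ : Representation ℂ G V) (g : G) : ρ g⁻¹ * ρ g = 1 := by
  rw [← map_mul, inv_mul_cancel, map_one]

/-- `P` projects onto a block of a system of imprimitivity whose blocks are all stabilized
by the normal subgroup `M`. -/
structure IsBlockProjection (ρ : Representation ℂ G V) (M : Subgroup G) (P : End ℂ V) :
    Prop where
  normal : M.Normal
  ne_zero : P ≠ 0
  idem : P * P = P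
  comm : ∀ y ∈ M, ρ y * P = P * ρ y
  mul_mul_eq_zero : ∀ g ∉ M, P * ρ g * P = 0

theorem isBlockProjection_one [Nontrivial V] (ρ : Representation ℂ G V) :
    IsBlockProjection ρ ⊤ 1 where
  normal := inferInstance
  ne_zero := one_ne_zero
  idem := one_mul 1
  comm y _ := by rw [one_mul, mul_one]
  mul_mul_eq_zero g hg := (hg (Subgroup.mem_top g)).elim

/-- `k` is central in `M` modulo the elements acting by scalars on the range of `P`, and `γ`
describes the commutators with `k` on this range. -/
structure IsTwist (ρ : Representation ℂ G V) (M : Subgroup G) (P : End ℂ V) (p : ℕ) (k : G)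
    (γ : G → ℂ) : Prop where
  mem : k ∈ M
  conj : ∀ g, ∃ l ∈ M, l ∈ scalarStabilizer ρ P ∧ g * k * g⁻¹ = l * k
  pow_mem : k ^ p ∈ scalarStabilizer ρ P
  apply : ∀ y ∈ M, ρ (y * k * y⁻¹) * P = γ y • (ρ k * P)
  pow_eq_one : ∀ y ∈ M, γ y ^ p = 1
  exists_ne_one : ∃ x ∈ M, γ x ≠ 1

namespace IsBlockProjection

variable {ρ : Representation ℂ G V} {M : Subgroup G} {P : End ℂ V}

theorem apply_mul_ne_zero (hP : IsBlockProjection ρ M P) (g : G) : ρ g * P ≠ 0 := by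
  intro h
  apply hP.ne_zero
  rw [← one_mul P, ← inv_mul_cancel_apply ρ g, mul_assoc, h, mul_zero]

theorem smul_cancel (hP : IsBlockProjection ρ M P) {g : G} {a b : ℂ}
    (h : a • (ρ g * P) = b • (ρ g * P)) : a = b :=
  smul_left_injective ℂ (hP.apply_mul_ne_zero g) h

theorem conj_scalar (hP : IsBlockProjection ρ M P) {k y : G} (hy : y ∈ M) {c : ℂ}
    (hk : ρ k * P = c • P) : ρ (y * k * y⁻¹) * P = c • P := by
  rw [map_mul, map_mul, mul_assoc, hP.comm _ (M.inv_mem hy), mul_assoc, ← mul_assoc (ρ k), hk,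
    smul_mul_assoc, mul_smul_comm, ← mul_assoc, hP.comm y hy, mul_assoc, mul_inv_cancel_apply,
    mul_one]

theorem conj_pow (hP : IsBlockProjection ρ M P) {k y : G} (hk : k ∈ M) {c : ℂ}
    (hc : ρ (y * k * y⁻¹) * P = c • (ρ k * P)) (j : ℕ) :
    ρ (y * k ^ j * y⁻¹) * P = c ^ j • (ρ (k ^ j) * P) := by
  induction j with
  | zero => rw [pow_zero, mul_one, mul_inv_cancel, pow_zero, one_smul]
  | succ j ih =>
    have hmul : y * k ^ (j + 1) * y⁻¹ = (y * k ^ j * y⁻¹) * (y * k * y⁻¹) := by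
      rw [pow_succ]; group
    rw [hmul, map_mul, mul_assoc, hc, mul_smul_comm, hP.comm k hk, ← mul_assoc, ih,
      smul_mul_assoc, mul_assoc, ← hP.comm k hk, ← mul_assoc, ← map_mul, ← pow_succ, smul_smul,
      ← pow_succ']

/-- By Schur's lemma, an element commuting with `M` on the range of `P` acts as a scalar. -/
theorem mem_scalarStabilizer_of_commute [Finite G] [FiniteDimensional ℂ V]
    (hρ : IsIrreducible ρ) (hP : IsBlockProjection ρ M P) {k : G} (hk : k ∈ M)
    (hcomm : ∀ y ∈ M, ρ (y * k * y⁻¹) * P = ρ k * P) : k ∈ scalarStabilizer ρ P := by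
  let : Fintype G := Fintype.ofFinite G
  have := hP.normal
  let T : End ℂ V := ∑ g : G, ρ g * (ρ k * P) * ρ g⁻¹
  have hTcomm : ∀ h, T * ρ h = ρ h * T := by
    intro h
    simp only [T, Finset.sum_mul, Finset.mul_sum]
    rw [← Equiv.sum_comp (Equiv.mulLeft h)]
    refine Finset.sum_congr rfl fun g _ => ?_
    rw [Equiv.coe_mulLeft, mul_inv_rev, map_mul ρ h g, map_mul ρ g⁻¹ h⁻¹]
    simp only [mul_assoc, inv_mul_cancel_apply, mul_one]
  let f : IntertwiningMap ρ ρ :=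
    { toLinearMap := T, isIntertwining' := fun g => hTcomm g }
  obtain ⟨t, ht⟩ :=
    (IsIrreducible.algebraMap_intertwiningMap_bijective_of_isAlgClosed (ρ := ρ)).2 f
  have hT : T = t • 1 := by
    ext v
    have := congrArg (fun F : IntertwiningMap ρ ρ => F v) ht
    simpa [f] using this.symm
  have hterm : ∀ g, P * (ρ g * (ρ k * P) * ρ g⁻¹) = if g ∈ M then ρ k * P else 0 := by
    intro g
    split_ifs with hg
    · rw [mul_assoc (ρ g), mul_assoc (ρ k), ← hP.comm _ (M.inv_mem hg), ← mul_assoc (ρ k),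
        ← mul_assoc (ρ g), ← mul_assoc (ρ g), ← map_mul, ← map_mul, hcomm g hg,
        hP.comm k hk, ← mul_assoc, hP.idem]
    · rw [hP.comm k hk, ← mul_assoc (ρ g), ← mul_assoc P, ← mul_assoc P, ← mul_assoc P,
        hP.mul_mul_eq_zero g hg, zero_mul, zero_mul]
  have hPT : (Fintype.card M : ℂ) • (ρ k * P) = t • P := by
    calc (Fintype.card M : ℂ) • (ρ k * P) = P * T := by
          simp only [T, Finset.mul_sum, hterm]
          rw [← Finset.sum_filter, Finset.sum_const, Nat.cast_smul_eq_nsmul, Fintype.card_subtype]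
      _ = t • P := by rw [hT, mul_smul_comm, mul_one]
  have hcard : (Fintype.card M : ℂ) ≠ 0 := Nat.cast_ne_zero.mpr Fintype.card_ne_zero
  refine ⟨(Fintype.card M : ℂ)⁻¹ * t, ?_⟩
  rw [mul_smul, ← hPT, smul_smul, inv_mul_cancel₀ hcard, one_smul]

theorem exists_isTwist [Finite G] [FiniteDimensional ℂ V] {p : ℕ} (hp : p.Prime)
    (hG : IsPGroup p G) (hρ : IsIrreducible ρ) (hP : IsBlockProjection ρ M P)
    (hM : ¬ M ≤ scalarStabilizer ρ P) : ∃ k γ, IsTwist ρ M P p k γ := by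
  have := hP.normal
  have hLM : M ⊓ (scalarStabilizer ρ P).normalCore < M :=
    lt_of_le_of_ne inf_le_left fun h =>
      hM ((inf_eq_left.mp h).trans (Subgroup.normalCore_le _))
  obtain ⟨k, hk, hkL, hconj, hpow⟩ := hG.exists_commutator_mem_pow_mem hp hLM
  have hconj' : ∀ g, ∃ l ∈ M, l ∈ scalarStabilizer ρ P ∧ g * k * g⁻¹ = l * k := fun g =>
    ⟨g * k * g⁻¹ * k⁻¹, (hconj g).1, Subgroup.normalCore_le _ (hconj g).2, by group⟩
  have hkP : k ∉ scalarStabilizer ρ P := by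
    intro h
    refine hkL ⟨hk, fun g => ?_⟩
    obtain ⟨l, -, hl, hlk⟩ := hconj' g
    rw [hlk]
    exact mul_mem hl h
  have happly : ∀ y, ∃ c : ℂ, ρ (y * k * y⁻¹) * P = c • (ρ k * P) := by
    intro y
    obtain ⟨l, -, ⟨c, hc⟩, hlk⟩ := hconj' y
    refine ⟨c, ?_⟩
    rw [hlk, map_mul, mul_assoc, hP.comm k hk, ← mul_assoc, hc, smul_mul_assoc]
  choose γ hγ using happly
  obtain ⟨c, hc⟩ := Subgroup.normalCore_le _ hpow.2
  refine ⟨k, γ, hk, hconj', ⟨c, hc⟩, fun y _ => hγ y, fun y hy => ?_, ?_⟩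
  · have h := hP.conj_pow hk (hγ y) p
    rw [hP.conj_scalar hy hc, ← hc] at h
    exact (hP.smul_cancel (h.symm.trans (one_smul _ _).symm))
  · by_contra! hall
    refine hkP (hP.mem_scalarStabilizer_of_commute hρ hk fun y hy => ?_)
    rw [hγ y, hall y hy, one_smul]

end IsBlockProjection

end Representation

namespace Representation

open Module

variable {G V : Type*} [Group G] [AddCommGroup V] [Module ℂ V]

namespace IsTwist

variable {ρ : Representation ℂ G V} {M : Subgroup G} {P : End ℂ V} {p : ℕ} {k : G} {γ : G → ℂ}

theorem map_eq_of_apply (hk : IsTwist ρ M P p k γ) (hP : IsBlockProjection ρ M P) {y : G}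
    (hy : y ∈ M) {c : ℂ} (h : ρ (y * k * y⁻¹) * P = c • (ρ k * P)) : γ y = c :=
  hP.smul_cancel ((hk.apply y hy).symm.trans h)

theorem map_mul (hk : IsTwist ρ M P p k γ) (hP : IsBlockProjection ρ M P) {y z : G}
    (hy : y ∈ M) (hz : z ∈ M) : γ (y * z) = γ y * γ z := by
  apply hk.map_eq_of_apply hP (M.mul_mem hy hz)
  have hmul : y * z * k * (y * z)⁻¹ = y * (z * k * z⁻¹) * y⁻¹ := by group
  rw [hmul, _root_.map_mul, mul_assoc, hP.comm _ (M.inv_mem hy), ← mul_assoc, _root_.map_mul,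
    mul_assoc (ρ y), hk.apply z hz, mul_smul_comm, smul_mul_assoc, mul_assoc (ρ y),
    mul_assoc (ρ k), ← hP.comm _ (M.inv_mem hy), ← mul_assoc, ← mul_assoc, ← _root_.map_mul,
    ← _root_.map_mul, hk.apply y hy, smul_smul, mul_comm (γ z)]

theorem map_one (hk : IsTwist ρ M P p k γ) (hP : IsBlockProjection ρ M P) : γ 1 = 1 :=
  hk.map_eq_of_apply hP M.one_mem (by rw [one_mul, inv_one, mul_one, one_smul])

theorem map_pow (hk : IsTwist ρ M P p k γ) (hP : IsBlockProjection ρ M P) {y : G}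
    (hy : y ∈ M) (j : ℕ) : γ (y ^ j) = γ y ^ j := by
  induction j with
  | zero => rw [pow_zero, pow_zero, hk.map_one hP]
  | succ j ih => rw [pow_succ, hk.map_mul hP (M.pow_mem hy j) hy, ih, pow_succ]

theorem map_inv_mul (hk : IsTwist ρ M P p k γ) (hP : IsBlockProjection ρ M P) {y : G}
    (hy : y ∈ M) : γ y⁻¹ * γ y = 1 := by
  rw [← hk.map_mul hP (M.inv_mem hy) hy, inv_mul_cancel, hk.map_one hP]

theorem map_conj_self (hk : IsTwist ρ M P p k γ) (hP : IsBlockProjection ρ M P) (g : G) :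
    γ (g * k * g⁻¹) = 1 := by
  obtain ⟨l, hl, hlP, hlk⟩ := hk.conj g
  have hk1 : γ k = 1 :=
    hk.map_eq_of_apply hP hk.mem (by rw [mul_inv_cancel_right, one_smul])
  have hl1 : γ l = 1 := by
    obtain ⟨c, hc⟩ := (scalarStabilizer ρ P).inv_mem hlP
    obtain ⟨d, hd⟩ := hlP
    refine hk.map_eq_of_apply hP hl ?_
    rw [one_smul, _root_.map_mul, mul_assoc, hc, mul_smul_comm, _root_.map_mul, mul_assoc,
      hP.comm k hk.mem, ← mul_assoc, ← smul_mul_assoc, ← mul_smul_comm, ← hc, ← mul_assoc,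
      mul_inv_cancel_apply, one_mul]
  rw [hlk, hk.map_mul hP hl hk.mem, hl1, hk1, one_mul]

/-- The kernel of `γ` on `M`. -/
def ker (hk : IsTwist ρ M P p k γ) (hP : IsBlockProjection ρ M P) : Subgroup G where
  carrier := {y | y ∈ M ∧ γ y = 1}
  one_mem' := ⟨M.one_mem, hk.map_one hP⟩
  mul_mem' := by
    rintro y z ⟨hy, hy1⟩ ⟨hz, hz1⟩
    exact ⟨M.mul_mem hy hz, by rw [hk.map_mul hP hy hz, hy1, hz1, one_mul]⟩
  inv_mem' := by
    rintro y ⟨hy, hy1⟩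
    exact ⟨M.inv_mem hy, by simpa [hy1] using hk.map_inv_mul hP hy⟩

theorem isPrimitiveRoot (hk : IsTwist ρ M P p k γ) (hp : p.Prime) {x : G} (hx : x ∈ M)
    (hx1 : γ x ≠ 1) : IsPrimitiveRoot (γ x) p := by
  have : Fact p.Prime := ⟨hp⟩
  rw [← orderOf_eq_prime (hk.pow_eq_one x hx) hx1]
  exact IsPrimitiveRoot.orderOf _

theorem apply_mul (hk : IsTwist ρ M P p k γ) (hP : IsBlockProjection ρ M P) {x : G}
    (hx : x ∈ M) : ρ k * (ρ x * P) = γ x⁻¹ • (ρ x * P * ρ k) := by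
  have hmul : k * x = x * (x⁻¹ * k * x⁻¹⁻¹) := by group
  rw [← mul_assoc, ← _root_.map_mul, hmul, _root_.map_mul, mul_assoc, hk.apply _ (M.inv_mem hx),
    mul_smul_comm, hP.comm k hk.mem, ← mul_assoc]

theorem conj_apply_mul (hk : IsTwist ρ M P p k γ) (hP : IsBlockProjection ρ M P) {x : G}
    (hx : x ∈ M) (g : G) :
    ρ (g * k * g⁻¹) * (ρ x * P) * ρ (g * k * g⁻¹)⁻¹ = γ x⁻¹ • (ρ x * P) := by
  obtain ⟨l, hl, ⟨c, hc⟩, hlk⟩ := hk.conj g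
  have hlx : ρ l * (ρ x * P) * ρ l⁻¹ = ρ x * P := by
    rw [hP.comm x hx, ← mul_assoc, hc, smul_mul_assoc, ← hP.comm x hx, ← mul_smul_comm, ← hc,
      hP.comm l hl, mul_assoc, mul_assoc, mul_inv_cancel_apply, mul_one]
  rw [hlk, mul_inv_rev, _root_.map_mul, _root_.map_mul, mul_assoc (ρ l), hk.apply_mul hP hx,
    mul_smul_comm, smul_mul_assoc, ← mul_assoc, mul_assoc (ρ l), mul_assoc _ (ρ k),
    mul_inv_cancel_apply, mul_one, hlx]

theorem conj_pow_self (hk : IsTwist ρ M P p k γ) (hP : IsBlockProjection ρ M P) {y : G}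
    (hy : y ∈ M) (j : ℕ) :
    ρ y * (ρ (k ^ j) * P) * ρ y⁻¹ = γ y ^ j • (ρ (k ^ j) * P) := by
  rw [← hP.conj_pow hk.mem (hk.apply y hy) j, _root_.map_mul, _root_.map_mul, mul_assoc _ (ρ y⁻¹),
    hP.comm _ (M.inv_mem hy), ← mul_assoc, ← mul_assoc]

theorem exists_conj_eq [Finite G] (hk : IsTwist ρ M P p k γ) (hP : IsBlockProjection ρ M P)
    (hp : p.Prime) (hG : IsPGroup p G) :
    ∃ q ∈ M, γ q ≠ 1 ∧ ∀ g, γ (g * q * g⁻¹) = γ q := by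
  have := hP.normal
  obtain ⟨x, hx, hx1⟩ := hk.exists_ne_one
  have hlt : M ⊓ (hk.ker hP).normalCore < M :=
    lt_of_le_of_ne inf_le_left fun h =>
      hx1 (((inf_eq_left.mp h).trans (Subgroup.normalCore_le _)) hx).2
  obtain ⟨q, hq, hqL, hconj, -⟩ := hG.exists_commutator_mem_pow_mem hp hlt
  have hconst : ∀ g, γ (g * q * g⁻¹) = γ q := by
    intro g
    have hmul : g * q * g⁻¹ = g * q * g⁻¹ * q⁻¹ * q := by group
    have hmem := Subgroup.normalCore_le _ (hconj g).2
    rw [hmul, hk.map_mul hP hmem.1 hq, hmem.2, one_mul]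
  refine ⟨q, hq, fun hq1 => hqL ⟨hq, fun g => ⟨hP.normal.conj_mem q hq g, ?_⟩⟩, hconst⟩
  rw [hconst, hq1]

theorem le_finrank_range [FiniteDimensional ℂ V] (hk : IsTwist ρ M P p k γ)
    (hP : IsBlockProjection ρ M P) (hp : p.Prime) : p ≤ finrank ℂ (LinearMap.range P) := by
  have hinv : ∀ v ∈ LinearMap.range P, ∀ y ∈ M, ρ y v ∈ LinearMap.range P := by
    rintro _ ⟨v, rfl⟩ y hy
    exact ⟨ρ y v, by rw [← End.mul_apply, ← hP.comm y hy, End.mul_apply]⟩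
  have : Nontrivial (LinearMap.range P) :=
    Submodule.nontrivial_iff_ne_bot.mpr fun h => hP.ne_zero (LinearMap.range_eq_bot.mp h)
  obtain ⟨a, ha⟩ := End.exists_eigenvalue
    ((ρ k).restrict (p := LinearMap.range P) (q := LinearMap.range P)
      fun v hv => hinv v hv k hk.mem)
  obtain ⟨⟨v, w, rfl⟩, hv, hv0⟩ := ha.exists_hasEigenvector
  rw [End.mem_eigenspace_iff, Subtype.ext_iff] at hv
  replace hv : ρ k (P w) = a • P w := hv
  replace hv0 : P w ≠ 0 := fun h => hv0 (Subtype.ext h)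
  obtain ⟨x, hx, hx1⟩ := hk.exists_ne_one
  have hω := hk.isPrimitiveRoot hp hx hx1
  have hinj : ∀ g, Function.Injective (ρ g) := fun g =>
    Function.LeftInverse.injective (g := ρ g⁻¹) fun u => by
      rw [← End.mul_apply, inv_mul_cancel_apply, End.one_apply]
  have ha0 : a ≠ 0 := by
    rintro rfl
    rw [zero_smul] at hv
    exact hv0 (hinj k (hv.trans (_root_.map_zero (ρ k)).symm))
  have heig : ∀ j : Fin p, End.HasEigenvector (ρ k) (γ x ^ (j : ℕ) * a)
      (ρ (x ^ (j : ℕ))⁻¹ (P w)) := by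
    intro j
    refine ⟨End.mem_eigenspace_iff.mpr ?_, fun h => hv0 (hinj _ (h.trans (map_zero _).symm))⟩
    have h := congrArg (fun T : End ℂ V => T (P w))
      (hk.apply_mul hP (M.inv_mem (M.pow_mem hx j)))
    simp only [End.mul_apply, LinearMap.smul_apply] at h
    rw [hv, map_smul, map_smul, ← End.mul_apply P P, hP.idem, inv_inv, hk.map_pow hP hx,
      smul_smul] at h
    exact h
  have hli : LinearIndependent ℂ fun j : Fin p => ρ (x ^ (j : ℕ))⁻¹ (P w) := by
    refine End.eigenvectors_linearIndependent' (ρ k) (fun j : Fin p => γ x ^ (j : ℕ) * a) ?_ _ heig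
    intro i j hij
    exact Fin.ext (hω.pow_inj i.2 j.2 (mul_right_cancel₀ ha0 hij))
  have hli' : LinearIndependent ℂ fun j : Fin p =>
      (⟨ρ (x ^ (j : ℕ))⁻¹ (P w), hinv _ ⟨w, rfl⟩ _ (M.inv_mem (M.pow_mem hx j))⟩ :
        LinearMap.range P) :=
    LinearIndependent.of_comp (LinearMap.range P).subtype hli
  simpa using hli'.fintype_card_le_finrank

end IsTwist

theorem IsBlockProjection.mul_finrank_range_le [FiniteDimensional ℂ V]
    {ρ : Representation ℂ G V} {M : Subgroup G} {P : End ℂ V} (hP : IsBlockProjection ρ M P)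
    {r : ℕ} (s : Fin r → G) (hs : ∀ i j, i ≠ j → (s i)⁻¹ * s j ∉ M) :
    r * finrank ℂ (LinearMap.range P) ≤ finrank ℂ V := by
  let f : (Fin r → LinearMap.range P) →ₗ[ℂ] V :=
    ∑ i, ρ (s i) ∘ₗ (LinearMap.range P).subtype ∘ₗ LinearMap.proj i
  have hf : Function.Injective f := by
    rw [← LinearMap.ker_eq_bot, LinearMap.ker_eq_bot']
    intro u hu
    ext i
    have hPu : ∀ j, P (u j) = u j := by
      intro j
      obtain ⟨w, hw⟩ := (u j).2
      rw [← hw, ← End.mul_apply, hP.idem]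
    have h1 : P (ρ (s i)⁻¹ (f u)) = 0 := by rw [hu, map_zero, map_zero]
    have h2 : P (ρ (s i)⁻¹ (f u)) = u i := by
      simp only [f, LinearMap.sum_apply, LinearMap.comp_apply, map_sum, LinearMap.proj_apply,
        Submodule.subtype_apply]
      rw [Finset.sum_eq_single i]
      · rw [← End.mul_apply (ρ _) (ρ _), inv_mul_cancel_apply, End.one_apply, hPu]
      · intro j _ hj
        rw [← hPu j, ← End.mul_apply (ρ _) (ρ _), ← map_mul, ← End.mul_apply, ← End.mul_apply,
          hP.mul_mul_eq_zero _ (hs i j hj.symm), LinearMap.zero_apply]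
      · intro h
        exact (h (Finset.mem_univ i)).elim
    rw [← h2, h1]
    rfl
  have h := LinearMap.finrank_le_finrank_of_injective hf
  rw [Module.finrank_pi_fintype, Finset.sum_const, Finset.card_univ, Fintype.card_fin,
    smul_eq_mul] at h
  exact h

end Representation

namespace Representation

open Module

section Bounds

variable {G V : Type*} [Group G] [AddCommGroup V] [Module ℂ V] {ρ : Representation ℂ G V}

theorem IsTwist.exists_isBlockProjection [FiniteDimensional ℂ V] {p : ℕ} {n : G} {ζ : G → ℂ}
    (hn : IsTwist ρ ⊤ 1 p n ζ) (h1 : IsBlockProjection ρ ⊤ 1) (hp : p.Prime) :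
    ∃ P, IsBlockProjection ρ (hn.ker h1) P := by
  have hpC : (p : ℂ) ≠ 0 := Nat.cast_ne_zero.mpr hp.ne_zero
  have : Nontrivial V := by
    by_contra h
    rw [not_nontrivial_iff_subsingleton] at h
    exact h1.ne_zero (LinearMap.ext fun v => Subsingleton.elim _ _)
  obtain ⟨a, ha⟩ := End.exists_eigenvalue (ρ n)
  obtain ⟨v, hv, hv0⟩ := ha.exists_hasEigenvector
  rw [End.mem_eigenspace_iff] at hv
  obtain ⟨c, hc⟩ := hn.pow_mem
  have hpowv : ∀ i : ℕ, (ρ n ^ i) v = a ^ i • v := by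
    intro i
    induction i with
    | zero => rw [pow_zero, pow_zero, one_smul, End.one_apply]
    | succ i ih => rw [pow_succ, End.mul_apply, hv, map_smul, ih, smul_smul, pow_succ']
  rw [mul_one, _root_.map_pow] at hc
  have hac : c = a ^ p := by
    have h := hpowv p
    rw [hc] at h
    exact smul_left_injective ℂ hv0 h
  have ha0 : a ≠ 0 := by
    rintro rfl
    apply hv0
    have h : (ρ n⁻¹ * ρ n) v = 0 := by rw [End.mul_apply, hv, zero_smul, map_zero]
    rwa [inv_mul_cancel_apply] at h
  set N : End ℂ V := a⁻¹ • ρ n with hN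
  have hNp : N ^ p = 1 := by
    rw [hN, smul_pow, hc, hac, smul_smul, inv_pow, inv_mul_cancel₀ (pow_ne_zero p ha0), one_smul]
  set P : End ℂ V := (p : ℂ)⁻¹ • ∑ i ∈ Finset.range p, N ^ i with hPdef
  have hNP : N * P = P := by
    rw [hPdef, mul_smul_comm, Finset.mul_sum]
    congr 1
    have h := Finset.sum_range_succ' (fun i => N ^ i) p
    rw [Finset.sum_range_succ, hNp, pow_zero, add_left_inj] at h
    rw [h]
    exact Finset.sum_congr rfl fun i _ => (pow_succ' N i).symm
  have hNiP : ∀ i : ℕ, N ^ i * P = P := by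
    intro i
    induction i with
    | zero => rw [pow_zero, one_mul]
    | succ i ih => rw [pow_succ, mul_assoc, hNP, ih]
  refine ⟨P, ?_, ?_, ?_, ?_, ?_⟩
  · refine ⟨fun y hy g => ⟨(Subgroup.mem_top _), ?_⟩⟩
    rw [hn.map_mul h1 (Subgroup.mem_top _) (Subgroup.mem_top _), hn.map_mul h1 (Subgroup.mem_top _) (Subgroup.mem_top _), hy.2, mul_one, mul_comm,
      hn.map_inv_mul h1 (Subgroup.mem_top _)]
  · intro h
    apply hv0
    have hNv : ∀ i : ℕ, (N ^ i) v = v := by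
      intro i
      rw [hN, smul_pow, LinearMap.smul_apply, hpowv, smul_smul, inv_pow,
        inv_mul_cancel₀ (pow_ne_zero i ha0), one_smul]
    have hPv : P v = v := by
      rw [hPdef, LinearMap.smul_apply, LinearMap.sum_apply, Finset.sum_congr rfl fun i _ => hNv i,
        Finset.sum_const, Finset.card_range, ← Nat.cast_smul_eq_nsmul ℂ, smul_smul,
        inv_mul_cancel₀ hpC, one_smul]
    rw [← hPv, h, LinearMap.zero_apply]
  · conv_lhs => enter [1]; rw [hPdef]
    rw [smul_mul_assoc, Finset.sum_mul, Finset.sum_congr rfl fun i _ => hNiP i,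
      Finset.sum_const, Finset.card_range, ← Nat.cast_smul_eq_nsmul ℂ, smul_smul,
      inv_mul_cancel₀ hpC, one_smul]
  · rintro y ⟨-, hy⟩
    have h := hn.apply y (Subgroup.mem_top _)
    rw [hy, one_smul, mul_one, mul_one] at h
    have hcomm : Commute (ρ y) (ρ n) := by
      rw [Commute, SemiconjBy]
      conv_rhs => rw [← h]
      rw [← _root_.map_mul, ← _root_.map_mul, inv_mul_cancel_right]
    exact (Commute.sum_right _ _ _ fun i _ => (hcomm.smul_right a⁻¹).pow_right i).smul_right _
  · intro g hg
    have hz : ζ g⁻¹ ≠ 1 := by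
      intro h
      refine hg ⟨(Subgroup.mem_top _), ?_⟩
      simpa [h] using hn.map_inv_mul h1 (y := g) (Subgroup.mem_top _)
    have hNg : N * (ρ g * P) = ζ g⁻¹ • (ρ g * P) := by
      have h := hn.apply_mul h1 (x := g) (Subgroup.mem_top _)
      rw [mul_one] at h
      have h' : N * ρ g = ζ g⁻¹ • (ρ g * N) := by
        rw [hN, smul_mul_assoc, h, mul_smul_comm, smul_comm]
      rw [← mul_assoc, h', smul_mul_assoc, mul_assoc, hNP]
    have hNig : ∀ i : ℕ, N ^ i * (ρ g * P) = ζ g⁻¹ ^ i • (ρ g * P) := by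
      intro i
      induction i with
      | zero => rw [pow_zero, pow_zero, one_mul, one_smul]
      | succ i ih => rw [pow_succ, mul_assoc, hNg, mul_smul_comm, ih, smul_smul, pow_succ']
    rw [mul_assoc]
    conv_lhs => enter [1]; rw [hPdef]
    rw [smul_mul_assoc, Finset.sum_mul, Finset.sum_congr rfl fun i _ => hNig i, ← Finset.sum_smul,
      geom_sum_eq hz, hn.pow_eq_one _ (Subgroup.mem_top _), sub_self, zero_div, zero_smul, smul_zero]

theorem IsTwist.finrank_le [FiniteDimensional ℂ V] (hρ : IsIrreducible ρ) {p : ℕ} {n : G}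
    {ζ : G → ℂ} (hn : IsTwist ρ ⊤ 1 p n ζ) (h1 : IsBlockProjection ρ ⊤ 1) (hp : p.Prime)
    {P : End ℂ V} (hP : IsBlockProjection ρ (hn.ker h1) P)
    (hle : hn.ker h1 ≤ scalarStabilizer ρ P) : finrank ℂ V ≤ p := by
  obtain ⟨x, -, hx1⟩ := hn.exists_ne_one
  have hω := hn.isPrimitiveRoot hp (x := x) (Subgroup.mem_top _) hx1
  obtain ⟨w, hw⟩ : ∃ w, P w ≠ 0 := by
    by_contra! h
    exact hP.ne_zero (LinearMap.ext h)
  let S : Subrepresentation ρ :=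
    { toSubmodule := Submodule.span ℂ (Set.range fun i : Fin p => ρ (x ^ (i : ℕ)) (P w))
      apply_mem_toSubmodule := by
        intro g v hv
        induction hv using Submodule.span_induction with
        | mem v hv =>
          obtain ⟨i, rfl⟩ := hv
          have : NeZero p := ⟨hp.ne_zero⟩
          obtain ⟨j, hj, hjeq⟩ :=
            hω.eq_pow_of_pow_eq_one (hn.pow_eq_one (g * x ^ (i : ℕ)) (Subgroup.mem_top _))
          have hmem : (x ^ j)⁻¹ * (g * x ^ (i : ℕ)) ∈ hn.ker h1 := by
            refine ⟨(Subgroup.mem_top _), ?_⟩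
            rw [hn.map_mul h1 (Subgroup.mem_top _) (Subgroup.mem_top _), ← hjeq, ← hn.map_pow h1 (Subgroup.mem_top _),
              hn.map_inv_mul h1 (Subgroup.mem_top _)]
          obtain ⟨c, hc⟩ := hle hmem
          have h : ρ g (ρ (x ^ (i : ℕ)) (P w)) = c • ρ (x ^ j) (P w) := by
            rw [← End.mul_apply, ← _root_.map_mul, ← map_smul, ← LinearMap.smul_apply, ← hc,
              ← End.mul_apply, ← End.mul_apply, ← mul_assoc, ← _root_.map_mul, mul_inv_cancel_left]
          rw [h]
          exact Submodule.smul_mem _ _ (Submodule.subset_span ⟨⟨j, hj⟩, rfl⟩)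
        | zero => rw [map_zero]; exact Submodule.zero_mem _
        | add a b _ _ ha hb => rw [map_add]; exact Submodule.add_mem _ ha hb
        | smul c a _ ha => rw [map_smul]; exact Submodule.smul_mem _ c ha }
  have hS : S = ⊤ := by
    refine (hρ.eq_bot_or_eq_top S).resolve_left fun h => hw ?_
    have hmem : P w ∈ S.toSubmodule :=
      Submodule.subset_span ⟨⟨0, hp.pos⟩, by simp⟩
    rw [h] at hmem
    exact hmem
  have htop : Submodule.span ℂ (Set.range fun i : Fin p => ρ (x ^ (i : ℕ)) (P w)) = ⊤ :=
    congrArg Subrepresentation.toSubmodule hS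
  have h := finrank_range_le_card (R := ℂ) fun i : Fin p => ρ (x ^ (i : ℕ)) (P w)
  rwa [Set.finrank, htop, finrank_top, Fintype.card_fin] at h

theorem IsTwist.sq_le_finrank [FiniteDimensional ℂ V] {p : ℕ} {n : G}
    {ζ : G → ℂ} (hn : IsTwist ρ ⊤ 1 p n ζ) (h1 : IsBlockProjection ρ ⊤ 1) (hp : p.Prime)
    {P : End ℂ V} (hP : IsBlockProjection ρ (hn.ker h1) P) {k : G} {γ : G → ℂ}
    (hk : IsTwist ρ (hn.ker h1) P p k γ) : p ^ 2 ≤ finrank ℂ V := by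
  obtain ⟨x, -, hx1⟩ := hn.exists_ne_one
  have hω := hn.isPrimitiveRoot hp (x := x) (Subgroup.mem_top _) hx1
  rw [pow_two]
  refine (Nat.mul_le_mul_left p (hk.le_finrank_range hP hp)).trans
    (hP.mul_finrank_range_le (fun i : Fin p => x ^ (i : ℕ)) fun i j hij hmem => hij ?_)
  have h := hmem.2
  rw [hn.map_mul h1 (Subgroup.mem_top _) (Subgroup.mem_top _)] at h
  have h' := hn.map_inv_mul h1 (y := x ^ (i : ℕ)) (Subgroup.mem_top _)
  have hne : ζ (x ^ (i : ℕ))⁻¹ ≠ 0 := left_ne_zero_of_mul_eq_one h'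
  have heq := mul_left_cancel₀ hne (h'.trans h.symm)
  rw [hn.map_pow h1 (Subgroup.mem_top _), hn.map_pow h1 (Subgroup.mem_top _)] at heq
  exact Fin.ext (hω.pow_inj i.2 j.2 heq)

theorem IsBlockProjection.conj_apply_mul {M : Subgroup G} {P : End ℂ V}
    (hP : IsBlockProjection ρ M P) {m : G} (hm : m ∈ M) (x : G) :
    ρ m * (ρ x * P) * ρ m⁻¹ = ρ (m * x * m⁻¹) * P := by
  rw [map_mul, map_mul, mul_assoc (ρ m * ρ x), hP.comm _ (M.inv_mem hm), mul_assoc, mul_assoc,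
    mul_assoc]

theorem IsTwist.map_conj_top {p : ℕ} {n : G} {ζ : G → ℂ} (hn : IsTwist ρ ⊤ 1 p n ζ)
    (h1 : IsBlockProjection ρ ⊤ 1) (g x : G) : ζ (g * x * g⁻¹) = ζ x := by
  rw [hn.map_mul h1 (Subgroup.mem_top _) (Subgroup.mem_top _),
    hn.map_mul h1 (Subgroup.mem_top _) (Subgroup.mem_top _), mul_comm, ← mul_assoc,
    hn.map_inv_mul h1 (Subgroup.mem_top _), one_mul]

theorem IsTwist.commute_conj {p : ℕ} {n : G} {ζ : G → ℂ} (hn : IsTwist ρ ⊤ 1 p n ζ)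
    (h1 : IsBlockProjection ρ ⊤ 1) {x : G} (hx : x ∈ hn.ker h1) (g : G) :
    Commute (ρ (g * n * g⁻¹)) (ρ x) := by
  have h := hn.conj_apply_mul h1 (Subgroup.mem_top x) g
  rw [((hn.ker h1).inv_mem hx).2, one_smul, mul_one] at h
  rw [Commute, SemiconjBy]
  conv_rhs => rw [← h]
  rw [mul_assoc _ (ρ (g * n * g⁻¹)⁻¹), inv_mul_cancel_apply, mul_one]

theorem IsTwist.exists_inv_ne_one {M : Subgroup G} {P : End ℂ V} {p : ℕ} {k : G}
    {γ : G → ℂ} (hk : IsTwist ρ M P p k γ) : ∃ x ∈ M, γ x⁻¹ ≠ 1 := by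
  obtain ⟨x, hx, hx1⟩ := hk.exists_ne_one
  exact ⟨x⁻¹, M.inv_mem hx, by rwa [inv_inv]⟩

end Bounds

end Representation

namespace Representation

open Module

section Counting

variable {G V : Type} [Group G] [Finite G] [AddCommGroup V] [Module ℂ V] [FiniteDimensional ℂ V]
  {ρ : Representation ℂ G V}

theorem finite_constituents (τ : Representation ℂ G V) : (constituents G τ.character).Finite := by
  obtain ⟨F, hF, -⟩ := exists_finset_eq_constituents τ
  rw [← hF]
  exact F.finite_toSet

theorem exists_constituent_linHom (ρ : Representation ℂ G V) {T : End ℂ V} (hT : T ≠ 0) :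
    ∃ θ ∈ constituents G (linHom ρ ρ).character, θ 1 ≠ 0 ∧ ∀ (h : G) (c : ℂ),
      (∀ g : G, ρ (g * h * g⁻¹) * T * ρ (g * h * g⁻¹)⁻¹ = c • T) → θ h = c * θ 1 := by
  obtain ⟨θ, hθ, h1, h⟩ := exists_constituent_of_forall_conj (linHom ρ ρ) hT
  refine ⟨θ, hθ, h1, fun k c hk => h k c fun g => ?_⟩
  rw [← hk g, linHom_apply]
  rfl

theorem IsTwist.exists_constituent_apply_self {M : Subgroup G} {P : End ℂ V} {p : ℕ} {k : G}
    {γ : G → ℂ} (hk : IsTwist ρ M P p k γ) (hP : IsBlockProjection ρ M P) {x : G} (hx : x ∈ M)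
    (j : ℕ) : ∃ θ ∈ constituents G (linHom ρ ρ).character, θ 1 ≠ 0 ∧
      θ k = γ x⁻¹ ^ j * θ 1 ∧
      ∀ h ∈ M, (∀ g, Commute (ρ (g * h * g⁻¹)) (ρ x)) → θ h = θ 1 := by
  have := hP.normal
  obtain ⟨θ, hθ, hθ1, hθh⟩ := exists_constituent_linHom ρ (hP.apply_mul_ne_zero (x ^ j))
  refine ⟨θ, hθ, hθ1, hθh k _ fun g => ?_, fun h hh hc => ?_⟩
  · rw [hk.conj_apply_mul hP (M.pow_mem hx j), ← inv_pow, hk.map_pow hP (M.inv_mem hx)]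
  · rw [hθh h 1 fun g => ?_, one_mul]
    rw [hP.conj_apply_mul (this.conj_mem h hh g), one_smul, _root_.map_mul, _root_.map_mul,
      _root_.map_pow, ((hc g).pow_right j).eq, mul_assoc (ρ x ^ j), mul_inv_cancel_apply, mul_one]

theorem IsTwist.exists_constituent_apply {M : Subgroup G} {P : End ℂ V} {p : ℕ} {k : G}
    {γ : G → ℂ} (hk : IsTwist ρ M P p k γ) (hP : IsBlockProjection ρ M P) (j : ℕ) :
    ∃ θ ∈ constituents G (linHom ρ ρ).character, θ 1 ≠ 0 ∧
      ∀ h ∈ M, ∀ c, (∀ g, γ (g * h * g⁻¹) = c) → θ h = c ^ j * θ 1 := by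
  obtain ⟨θ, hθ, hθ1, hθh⟩ := exists_constituent_linHom ρ (hP.apply_mul_ne_zero (k ^ j))
  refine ⟨θ, hθ, hθ1, fun h hh c hc => hθh h _ fun g => ?_⟩
  rw [hk.conj_pow_self hP (hP.normal.conj_mem h hh g), hc]

theorem IsTwist.two_mul_sub_one_le_ncard {p : ℕ} (hp : p.Prime) {n : G} {ζ : G → ℂ}
    (hn : IsTwist ρ ⊤ 1 p n ζ) (h1 : IsBlockProjection ρ ⊤ 1) :
    2 * p - 1 ≤ (constituents G (linHom ρ ρ).character).ncard := by
  have hfin := finite_constituents (linHom ρ ρ)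
  obtain ⟨x, hx, hx1⟩ := hn.exists_inv_ne_one
  obtain ⟨y, hy, hy1⟩ := hn.exists_ne_one
  have hn1 : ∀ g, ζ (g * n * g⁻¹) = 1 := hn.map_conj_self h1
  have hfin1 := hfin.subset (Set.sep_subset _ fun θ => θ n = θ 1)
  have hfin2 := hfin1.subset (Set.sep_subset _ fun θ => θ y = θ 1)
  have h2 := Set.ncard_add_le_of_isPrimitiveRoot hfin
    (hn.isPrimitiveRoot hp (Subgroup.mem_top _) hx1) 1 n fun j _ _ => by
      obtain ⟨θ, hθ, hθ1, hθn, -⟩ := hn.exists_constituent_apply_self h1 hx j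
      exact ⟨θ, hθ, hθ1, hθn⟩
  have h3 := Set.ncard_add_le_of_isPrimitiveRoot hfin1
    (hn.isPrimitiveRoot hp (Subgroup.mem_top _) hy1) 1 y fun j _ _ => by
      obtain ⟨θ, hθ, hθ1, hθh⟩ := hn.exists_constituent_apply h1 j
      refine ⟨θ, ⟨hθ, ?_⟩, hθ1, hθh y hy _ fun g => hn.map_conj_top h1 g y⟩
      rw [hθh n (Subgroup.mem_top _) 1 hn1, one_pow, one_mul]
  have h4 := (Set.ncard_pos hfin2).mpr <| by
    obtain ⟨θ, hθ, -, hθh⟩ := hn.exists_constituent_apply h1 0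
    exact ⟨θ, ⟨hθ, by rw [hθh n (Subgroup.mem_top _) 1 hn1, one_pow, one_mul]⟩,
      by rw [hθh y hy _ fun g => hn.map_conj_top h1 g y, pow_zero, one_mul]⟩
  omega

theorem IsTwist.four_mul_sub_three_le_ncard {p : ℕ} (hp : p.Prime) (hG : IsPGroup p G) {n : G}
    {ζ : G → ℂ} (hn : IsTwist ρ ⊤ 1 p n ζ) (h1 : IsBlockProjection ρ ⊤ 1) {P : End ℂ V}
    (hP : IsBlockProjection ρ (hn.ker h1) P) {k : G} {γ : G → ℂ}
    (hk : IsTwist ρ (hn.ker h1) P p k γ) :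
    4 * p - 3 ≤ (constituents G (linHom ρ ρ).character).ncard := by
  have hfin := finite_constituents (linHom ρ ρ)
  obtain ⟨x, hx, hx1⟩ := hn.exists_inv_ne_one
  obtain ⟨y, hy, hy1⟩ := hk.exists_inv_ne_one
  obtain ⟨q, hq, hq1, hqconj⟩ := hk.exists_conj_eq hP hp hG
  obtain ⟨z, hz, hz1⟩ := hn.exists_ne_one
  have hnker : n ∈ hn.ker h1 := by
    refine ⟨Subgroup.mem_top _, ?_⟩
    simpa using hn.map_conj_self h1 1
  have hn1 : ∀ g, γ (g * n * g⁻¹) = 1 := by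
    intro g
    refine hk.map_eq_of_apply hP (hP.normal.conj_mem n hnker g) ?_
    rw [_root_.map_mul, _root_.map_mul, (hn.commute_conj h1 hk.mem g).eq, mul_assoc (ρ k),
      mul_inv_cancel_apply, mul_one, one_smul]
  have hζ : ∀ m ∈ hn.ker h1, ∀ g, ζ (g * m * g⁻¹) = 1 := fun m hm g => by
    rw [hn.map_conj_top h1, hm.2]
  have hfin1 := hfin.subset (Set.sep_subset _ fun θ => θ n = θ 1)
  have hfin2 := hfin1.subset (Set.sep_subset _ fun θ => θ k = θ 1)
  have hfin3 := hfin2.subset (Set.sep_subset _ fun θ => θ q = θ 1)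
  have hfin4 := hfin3.subset (Set.sep_subset _ fun θ => θ z = θ 1)
  have h2 := Set.ncard_add_le_of_isPrimitiveRoot hfin
    (hn.isPrimitiveRoot hp (Subgroup.mem_top _) hx1) 1 n fun j _ _ => by
      obtain ⟨θ, hθ, hθ1, hθn, -⟩ := hn.exists_constituent_apply_self h1 hx j
      exact ⟨θ, hθ, hθ1, hθn⟩
  have h3 := Set.ncard_add_le_of_isPrimitiveRoot hfin1
    (hk.isPrimitiveRoot hp ((hn.ker h1).inv_mem hy) hy1) 1 k fun j _ _ => by
      obtain ⟨θ, hθ, hθ1, hθk, hθh⟩ := hk.exists_constituent_apply_self hP hy j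
      exact ⟨θ, ⟨hθ, hθh n hnker (hn.commute_conj h1 hy)⟩, hθ1, hθk⟩
  have h4 := Set.ncard_add_le_of_isPrimitiveRoot hfin2
    (hk.isPrimitiveRoot hp hq hq1) 1 q fun j _ _ => by
      obtain ⟨θ, hθ, hθ1, hθh⟩ := hk.exists_constituent_apply hP j
      refine ⟨θ, ⟨⟨hθ, ?_⟩, ?_⟩, hθ1, hθh q hq _ hqconj⟩
      · rw [hθh n hnker 1 hn1, one_pow, one_mul]
      · rw [hθh k hk.mem 1 (hk.map_conj_self hP), one_pow, one_mul]
  have hmem : ∀ j : ℕ, ∃ θ ∈ {θ ∈ {θ ∈ {θ ∈ constituents G (linHom ρ ρ).character | θ n = θ 1} |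
      θ k = θ 1} | θ q = θ 1}, θ 1 ≠ 0 ∧ θ z = ζ z ^ j * θ 1 := by
    intro j
    obtain ⟨θ, hθ, hθ1, hθh⟩ := hn.exists_constituent_apply h1 j
    refine ⟨θ, ⟨⟨⟨hθ, ?_⟩, ?_⟩, ?_⟩, hθ1, hθh z hz _ fun g => hn.map_conj_top h1 g z⟩
    · rw [hθh n (Subgroup.mem_top _) 1 (hζ n hnker), one_pow, one_mul]
    · rw [hθh k (Subgroup.mem_top _) 1 (hζ k hk.mem), one_pow, one_mul]
    · rw [hθh q (Subgroup.mem_top _) 1 (hζ q hq), one_pow, one_mul]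
  have h5 := Set.ncard_add_le_of_isPrimitiveRoot hfin3
    (hn.isPrimitiveRoot hp (Subgroup.mem_top _) hz1) 1 z fun j _ _ => hmem j
  have h6 := (Set.ncard_pos hfin4).mpr <| by
    obtain ⟨θ, hθ, -, hθz⟩ := hmem 0
    exact ⟨θ, hθ, by rw [hθz, pow_zero, one_mul]⟩
  omega

end Counting

end Representation

namespace Representation

open Module

section SemiInvariants

variable {G V : Type*} [Group G] [AddCommGroup V] [Module ℂ V] [FiniteDimensional ℂ V]

/-- The linear characters of `G` afforded by invertible semi-invariant endomorphisms. -/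
def semiInvariantCharacters (ρ : Representation ℂ G V) : Subgroup (G →* ℂˣ) where
  carrier := {ξ | ∃ T : (End ℂ V)ˣ, ∀ g, ρ g * T = (ξ g : ℂ) • (T * ρ g : End ℂ V)}
  one_mem' := ⟨1, fun g => by simp⟩
  mul_mem' := by
    rintro ξ ψ ⟨T, hT⟩ ⟨S, hS⟩
    refine ⟨T * S, fun g => ?_⟩
    rw [Units.val_mul, ← mul_assoc, hT, smul_mul_assoc, mul_assoc, hS, mul_smul_comm, smul_smul,
      mul_assoc]
    rfl
  inv_mem' := by
    rintro ξ ⟨T, hT⟩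
    refine ⟨T⁻¹, fun g => ?_⟩
    have h : (↑T⁻¹ * ρ g : End ℂ V) = (ξ g : ℂ) • (ρ g * ↑T⁻¹ : End ℂ V) := by
      have h' := congrArg (fun A : End ℂ V => ↑T⁻¹ * A * ↑T⁻¹) (hT g)
      simpa [mul_assoc] using h'
    rw [h, smul_smul, MonoidHom.inv_apply, Units.inv_mul, one_smul]

theorem IsIrreducible.isUnit_of_forall_mul_eq {ρ : Representation ℂ G V} (hρ : IsIrreducible ρ)
    {T : End ℂ V} (hT : T ≠ 0) {ξ : G → ℂ} (h : ∀ g, ρ g * T * ρ g⁻¹ = ξ g • T) : IsUnit T := by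
  let S : Subrepresentation ρ :=
    { toSubmodule := LinearMap.ker T
      apply_mem_toSubmodule := by
        intro g v hv
        rw [LinearMap.mem_ker] at hv ⊢
        have h' := congrArg (fun A : End ℂ V => A (ρ g v)) (h g)
        simp only [End.mul_apply, LinearMap.smul_apply] at h'
        rw [← End.mul_apply (ρ g⁻¹), inv_mul_cancel_apply, End.one_apply, hv, map_zero] at h'
        have hξ : ξ g ≠ 0 := by
          intro h0
          apply hT
          have h'' := h g
          rw [h0, zero_smul] at h''
          calc T = ρ g⁻¹ * (ρ g * T * ρ g⁻¹) * ρ g := by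
                rw [mul_assoc, mul_assoc, inv_mul_cancel_apply, mul_one, ← mul_assoc,
                  inv_mul_cancel_apply, one_mul]
            _ = 0 := by rw [h'', mul_zero, zero_mul]
        exact (smul_eq_zero.mp h'.symm).resolve_left hξ }
  rw [LinearMap.isUnit_iff_ker_eq_bot]
  rcases hρ.eq_bot_or_eq_top S with hS | hS
  · exact congrArg Subrepresentation.toSubmodule hS
  · exact (hT (LinearMap.ker_eq_top.mp (congrArg Subrepresentation.toSubmodule hS))).elim

omit [FiniteDimensional ℂ V] in
theorem IsIrreducible.finrank_eq_one {ρ : Representation ℂ G V} (hρ : IsIrreducible ρ)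
    (h : ⊤ ≤ scalarStabilizer ρ 1) : finrank ℂ V = 1 := by
  obtain ⟨v, hv⟩ := hρ.exists_ne_zero
  let S : Subrepresentation ρ :=
    { toSubmodule := ℂ ∙ v
      apply_mem_toSubmodule := by
        intro g w hw
        obtain ⟨c, hc⟩ := h (Subgroup.mem_top g)
        rw [mul_one] at hc
        rw [hc]
        exact Submodule.smul_mem _ c hw }
  have hS : S = ⊤ := by
    refine (hρ.eq_bot_or_eq_top S).resolve_left fun hbot => hv ?_
    have hmem : v ∈ S.toSubmodule := Submodule.mem_span_singleton_self v
    rw [hbot] at hmem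
    exact hmem
  have htop : ℂ ∙ v = ⊤ := congrArg Subrepresentation.toSubmodule hS
  rw [← finrank_top, ← htop, finrank_span_singleton hv]

theorem exists_isTwist_top [Finite G] {p : ℕ} (hp : p.Prime) (hG : IsPGroup p G)
    {ρ : Representation ℂ G V} (hρ : IsIrreducible ρ) (hV : finrank ℂ V ≠ 1) :
    ∃ (_ : IsBlockProjection ρ ⊤ 1) (n : G) (ζ : G → ℂ), IsTwist ρ ⊤ 1 p n ζ := by
  obtain ⟨v, hv⟩ := hρ.exists_ne_zero
  have : Nontrivial V := ⟨v, 0, hv⟩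
  have h1 := isBlockProjection_one ρ
  exact ⟨h1, h1.exists_isTwist hp hG hρ fun h => hV (hρ.finrank_eq_one h)⟩

theorem prime_le_finrank [Finite G] {p : ℕ} (hp : p.Prime) (hG : IsPGroup p G)
    {ρ : Representation ℂ G V} (hρ : IsIrreducible ρ) (hV : finrank ℂ V ≠ 1) :
    p ≤ finrank ℂ V := by
  obtain ⟨h1, n, ζ, hn⟩ := exists_isTwist_top hp hG hρ hV
  exact (hn.le_finrank_range h1 hp).trans (Submodule.finrank_le _)

end SemiInvariants

section PrimeDegree

variable {G V : Type} [Group G] [Finite G] [AddCommGroup V] [Module ℂ V] [FiniteDimensional ℂ V]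
  {ρ : Representation ℂ G V}

theorem exists_injective_semiInvariantCharacters (hρ : IsIrreducible ρ) :
    ∃ f : semiInvariantCharacters ρ → constituents G (linHom ρ ρ).character,
      Function.Injective f := by
  obtain ⟨v, hv⟩ := hρ.exists_ne_zero
  have : Nontrivial V := ⟨v, 0, hv⟩
  have H : ∀ ξ : semiInvariantCharacters ρ, ∃ θ : constituents G (linHom ρ ρ).character,
      θ.1 1 ≠ 0 ∧ ∀ h, θ.1 h = (ξ.1 h : ℂ) * θ.1 1 := by
    rintro ⟨ξ, T, hT⟩
    obtain ⟨θ, hθ, hθ1, hθh⟩ := exists_constituent_linHom ρ T.ne_zero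
    refine ⟨⟨θ, hθ⟩, hθ1, fun h => hθh h _ fun g => ?_⟩
    have hξ : ξ (g * h * g⁻¹) = ξ h := by
      rw [map_mul, map_mul, mul_comm, ← mul_assoc, ← map_mul, inv_mul_cancel, map_one, one_mul]
    rw [hT, smul_mul_assoc, mul_assoc (T : End ℂ V), mul_inv_cancel_apply, mul_one, hξ]
  choose f hf1 hfh using H
  refine ⟨f, fun ξ ψ h => ?_⟩
  ext g
  have h' := hfh ξ g
  rw [h, hfh ψ g] at h'
  exact (mul_right_cancel₀ (hf1 ψ) h').symm

theorem exists_mem_semiInvariantCharacters (hρ : IsIrreducible ρ) {θ : G → ℂ}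
    (hθ : θ ∈ constituents G (linHom ρ ρ).character) (h1 : θ 1 = 1) :
    ∃ ξ ∈ semiInvariantCharacters ρ, ∀ g, (ξ g : ℂ) = θ g := by
  obtain ⟨T, hT, hTθ⟩ := exists_eigenvector_of_constituent_degree_one (linHom ρ ρ) hθ h1
  have hmul : ∀ g h, θ (g * h) = θ g * θ h := by
    intro g h
    refine smul_left_injective ℂ hT ?_
    change θ (g * h) • T = (θ g * θ h) • T
    rw [← hTθ, map_mul, End.mul_apply, hTθ h, map_smul, hTθ g, smul_smul, mul_comm]
  have hconj : ∀ g, ρ g * T * ρ g⁻¹ = θ g • T := by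
    intro g
    rw [← hTθ g, linHom_apply]
    rfl
  obtain ⟨u, rfl⟩ := hρ.isUnit_of_forall_mul_eq hT hconj
  let φ : G →* ℂ := { toFun := θ, map_one' := h1, map_mul' := hmul }
  refine ⟨φ.toHomUnits, ⟨u, fun g => ?_⟩, fun g => rfl⟩
  change ρ g * (u : End ℂ V) = θ g • ((u : End ℂ V) * ρ g)
  rw [← smul_mul_assoc, ← hconj, mul_assoc _ (ρ g⁻¹), inv_mul_cancel_apply, mul_one]

omit [Finite G] [FiniteDimensional ℂ V] in
theorem IsTwist.semiInvariantCharacters_ne_bot {p : ℕ} {n : G} {ζ : G → ℂ}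
    (hn : IsTwist ρ ⊤ 1 p n ζ) (h1 : IsBlockProjection ρ ⊤ 1) :
    semiInvariantCharacters ρ ≠ ⊥ := by
  intro hbot
  obtain ⟨x, hx, hx1⟩ := hn.exists_ne_one
  let φ : G →* ℂ :=
    { toFun := ζ
      map_one' := hn.map_one h1
      map_mul' := fun g h => hn.map_mul h1 (Subgroup.mem_top g) (Subgroup.mem_top h) }
  have hφ : φ.toHomUnits ∈ semiInvariantCharacters ρ := by
    refine ⟨⟨ρ n, ρ n⁻¹, mul_inv_cancel_apply ρ n, inv_mul_cancel_apply ρ n⟩, fun g => ?_⟩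
    change ρ g * ρ n = ζ g • (ρ n * ρ g)
    have h := hn.apply g (Subgroup.mem_top g)
    rw [mul_one, mul_one] at h
    rw [← smul_mul_assoc, ← h, ← _root_.map_mul, ← _root_.map_mul, inv_mul_cancel_right]
  rw [hbot, Subgroup.mem_bot] at hφ
  exact hx1 (congrArg (fun ψ : G →* ℂˣ => (ψ x : ℂ)) hφ)

omit [FiniteDimensional ℂ V] in
theorem isPGroup_semiInvariantCharacters {p : ℕ} (hp : p.Prime) (hG : IsPGroup p G) :
    IsPGroup p (semiInvariantCharacters ρ) := by
  have : Fact p.Prime := ⟨hp⟩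
  obtain ⟨m, hm⟩ := hG.exists_card_eq
  refine fun ξ => ⟨m, Subtype.ext (MonoidHom.ext fun g => ?_)⟩
  change (ξ.1 g) ^ p ^ m = 1
  rw [← map_pow, ← hm, pow_card_eq_one', map_one]

theorem ncard_constituents_of_finrank_eq_prime {p : ℕ} (hp : p.Prime) (hG : IsPGroup p G)
    (hρ : IsIrreducible ρ) (hV : finrank ℂ V = p) :
    (constituents G (linHom ρ ρ).character).ncard = 2 * p - 1 ∨
      (constituents G (linHom ρ ρ).character).ncard = p ^ 2 := by
  have : Fact p.Prime := ⟨hp⟩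
  have hp2 := hp.two_le
  obtain ⟨h1, n, ζ, hn⟩ := exists_isTwist_top hp hG hρ (by omega)
  have hlow := hn.two_mul_sub_one_le_ncard hp h1
  obtain ⟨f, hf⟩ := exists_injective_semiInvariantCharacters hρ
  obtain ⟨F, hF, d, hd, hsum⟩ := exists_finset_eq_constituents (linHom ρ ρ)
  have hfinC := finite_constituents (linHom ρ ρ)
  have : Finite (constituents G (linHom ρ ρ).character) := hfinC
  have : Finite (semiInvariantCharacters ρ) := Finite.of_injective f hf
  have hle : Nat.card (semiInvariantCharacters ρ) ≤ F.card := by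
    rw [← Set.ncard_coe_finset, hF]
    exact Nat.card_le_card_of_injective f hf
  rw [finrank_linearMap, hV, ← pow_two] at hsum
  have hirr : ∀ θ ∈ F, 1 ≤ d θ ∧ (d θ ≠ 1 → p ≤ d θ) := by
    intro θ hθ
    have hθC : θ ∈ constituents G (linHom ρ ρ).character := hF ▸ hθ
    obtain ⟨U, _, _, _, σ, hσ, rfl⟩ := isIrrChar_iff_exists_isIrreducible.mp hθC.1
    obtain ⟨v, hv⟩ := hσ.exists_ne_zero
    have hdU : d σ.character = finrank ℂ U := by
      have h := hd _ hθ
      rw [char_one] at h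
      exact_mod_cast h.symm
    have : Nontrivial U := ⟨v, 0, hv⟩
    rw [hdU]
    exact ⟨finrank_pos, prime_le_finrank hp hG hσ⟩
  rw [← hF, Set.ncard_coe_finset] at hlow ⊢
  obtain ⟨m, hm⟩ := (isPGroup_semiInvariantCharacters (ρ := ρ) hp hG).exists_card_eq
  have hm0 : m ≠ 0 := by
    rintro rfl
    exact hn.semiInvariantCharacters_ne_bot h1 (Subgroup.card_eq_one.mp hm)
  have hcard : F.card ≤ p ^ 2 := by
    refine le_trans ?_ hsum
    rw [Finset.card_eq_sum_ones]
    exact Finset.sum_le_sum fun θ hθ => (hirr θ hθ).1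
  rcases eq_or_ne m 1 with rfl | hm1
  · left
    refine le_antisymm ?_ hlow
    have hlin : (F.filter fun θ => d θ = 1).card ≤ p := by
      rw [pow_one] at hm
      rw [← hm, ← Set.ncard_coe_finset]
      have H : ∀ θ : (F.filter fun θ => d θ = 1 : Set (G → ℂ)),
          ∃ ξ : semiInvariantCharacters ρ, ∀ g, (ξ.1 g : ℂ) = θ.1 g := by
        rintro ⟨θ, hθ⟩
        obtain ⟨hθF, hθ1⟩ := Finset.mem_filter.mp hθ
        obtain ⟨ξ, hξ, h⟩ := exists_mem_semiInvariantCharacters hρ (θ := θ) (hF ▸ hθF)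
          (by rw [hd θ hθF, hθ1, Nat.cast_one])
        exact ⟨⟨ξ, hξ⟩, h⟩
      choose e he using H
      refine Nat.card_le_card_of_injective e fun θ ψ h => Subtype.ext (funext fun g => ?_)
      rw [← he θ, ← he ψ, h]
    have hsplit := Finset.card_filter_add_card_filter_not (s := F) fun θ => d θ = 1
    have hsplit' := Finset.sum_filter_add_sum_filter_not F (fun θ => d θ = 1) d
    have hs1 : ∑ θ ∈ F with d θ = 1, d θ = (F.filter fun θ => d θ = 1).card := by
      rw [Finset.card_eq_sum_ones]
      exact Finset.sum_congr rfl fun θ hθ => (Finset.mem_filter.mp hθ).2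
    have hs2 : (F.filter fun θ => ¬ d θ = 1).card * p ≤ ∑ θ ∈ F with ¬ d θ = 1, d θ := by
      rw [← smul_eq_mul]
      exact Finset.card_nsmul_le_sum _ _ _ fun θ hθ =>
        (hirr θ (Finset.mem_filter.mp hθ).1).2 (Finset.mem_filter.mp hθ).2
    set A := (F.filter fun θ => d θ = 1).card
    set B := (F.filter fun θ => ¬ d θ = 1).card
    have hAB : A + B * p ≤ p * p := by rw [← pow_two]; omega
    rcases lt_or_ge B p with hB | hB
    · omega
    · have hBp : p * p ≤ B * p := Nat.mul_le_mul_right p hB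
      have hBle : B ≤ p := Nat.le_of_mul_le_mul_right (by omega : B * p ≤ p * p) hp.pos
      omega
  · right
    refine le_antisymm hcard (le_trans ?_ hle)
    rw [hm]
    exact Nat.pow_le_pow_right hp.pos (by omega)

theorem ncard_constituents_of_finrank_eq_one (hV : finrank ℂ V = 1) :
    (constituents G (linHom ρ ρ).character).ncard = 1 := by
  have : Nontrivial V := Module.nontrivial_of_finrank_eq_succ hV
  obtain ⟨θ, hθ, -⟩ := exists_constituent_linHom ρ (one_ne_zero (α := End ℂ V))
  obtain ⟨F, hF, d, hd, hsum⟩ := exists_finset_eq_constituents (linHom ρ ρ)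
  have hpos := (Set.ncard_pos (finite_constituents (linHom ρ ρ))).mpr ⟨θ, hθ⟩
  refine le_antisymm ?_ hpos
  rw [finrank_linearMap, hV] at hsum
  rw [← hF, Set.ncard_coe_finset]
  refine le_trans ?_ hsum
  rw [Finset.card_eq_sum_ones]
  refine Finset.sum_le_sum fun ψ hψ => ?_
  have hψC : ψ ∈ constituents G (linHom ρ ρ).character := hF ▸ hψ
  obtain ⟨U, _, _, _, σ, hσ, rfl⟩ := isIrrChar_iff_exists_isIrreducible.mp hψC.1
  obtain ⟨v, hv⟩ := hσ.exists_ne_zero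
  have hdU : d σ.character = finrank ℂ U := by
    have h := hd _ hψ
    rw [char_one] at h
    exact_mod_cast h.symm
  have : Nontrivial U := ⟨v, 0, hv⟩
  rw [hdU]
  exact finrank_pos

end PrimeDegree

end Representation

/-- **Theorem B.** Let `p` be a prime, `G` a finite `p`-group and `χ ∈ Irr(G)`. Then
exactly one of the following holds: (i) `χ(1) = 1` and `η(χ,χ̄) = 1`; (ii) `χ(1) = p` and
`η(χ,χ̄) = 2p - 1` or `p ^ 2`; (iii) `χ(1) ≥ p ^ 2` and `η(χ,χ̄) ≥ 4p - 3`.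
(The three alternatives are mutually exclusive since their degree conditions are.) -/
theorem products_of_characters_theorem_B {p : ℕ} (hp : p.Prime)
    (G : Type) [Group G] [Finite G] (hG : IsPGroup p G)
    (χ : G → ℂ) (hχ : IsIrrChar G χ) :
    (χ 1 = 1 ∧ eta G χ (conjChar χ) = 1) ∨
      (χ 1 = (p : ℂ) ∧
        (eta G χ (conjChar χ) = 2 * p - 1 ∨ eta G χ (conjChar χ) = p ^ 2)) ∨
      ((∃ d : ℕ, χ 1 = (d : ℂ) ∧ p ^ 2 ≤ d) ∧ 4 * p - 3 ≤ eta G χ (conjChar χ)) := by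
  obtain ⟨V, _, _, _, ρ, hρ, rfl⟩ := Representation.isIrrChar_iff_exists_isIrreducible.mp hχ
  rw [eta, ← Representation.character_linHom_self, Representation.char_one]
  by_cases h1 : Module.finrank ℂ V = 1
  · exact Or.inl ⟨by rw [h1, Nat.cast_one],
      Representation.ncard_constituents_of_finrank_eq_one h1⟩
  right
  obtain ⟨hone, n, ζ, hn⟩ := Representation.exists_isTwist_top hp hG hρ h1
  obtain ⟨P, hP⟩ := hn.exists_isBlockProjection hone hp
  by_cases hle : hn.ker hone ≤ Representation.scalarStabilizer ρ P
  · have hV : Module.finrank ℂ V = p :=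
      le_antisymm (hn.finrank_le hρ hone hp hP hle) (Representation.prime_le_finrank hp hG hρ h1)
    exact Or.inl ⟨by rw [hV], Representation.ncard_constituents_of_finrank_eq_prime hp hG hρ hV⟩
  · obtain ⟨k, γ, hk⟩ := hP.exists_isTwist hp hG hρ hle
    exact Or.inr ⟨⟨_, rfl, hn.sq_le_finrank hone hp hP hk⟩,
      hn.four_mul_sub_three_le_ncard hp hG hone hP hk⟩
end
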